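/- arXiv:1604.04119 — 12 statements merged into one kernel-verified Lean document; each statement's English description precedes it below -/
import Mathlib

section
/- Let X be a Banach space having property M(1,s) for some 0 < s ≤ 1, and suppose there exists a point x₀ in the unit sphere S_X at which the relative weak and norm topologies on S_X agree (i.e., the identity map from S_X with the weak topology to S_X with the norm topology is continuous at x₀). Then X has the GGLD property. -/
open Filter Topology

/-- The weak topology on a real normed space: the topology induced by all continuous
linear functionals. -/
noncomputable def weakTop (X : Type*) [NormedAddCommGroup X] [NormedSpace ℝ X] :
    TopologicalSpace X :=
  TopologicalSpace.induced (fun (x : X) (f : X →L[ℝ] ℝ) => f x) Pi.topologicalSpace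

/-- A net that is weakly convergent on all functionals converges in `weakTop`. -/
theorem tendsto_nhds_weakTop {X ι : Type*} [NormedAddCommGroup X] [NormedSpace ℝ X]
    {l : Filter ι} {y : ι → X} {a : X}
    (h : ∀ f : X →L[ℝ] ℝ, Tendsto (fun i => f (y i)) l (𝓝 (f a))) :
    Tendsto y l (@nhds X (weakTop X) a) := by
  unfold weakTop
  rw [nhds_induced, tendsto_comap_iff, tendsto_pi_nhds]
  exact h

/-- If the weak and norm topologies of the unit sphere agree at `x₀`, then weak convergence to
`x₀` together with convergence of norms implies norm convergence. -/
theorem tendsto_of_weak_of_norm {X ι : Type*} [NormedAddCommGroup X] [NormedSpace ℝ X]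
    {l : Filter ι} {x₀ : X} {z : ι → X}
    (hagree : Tendsto (id : X → X)
      (@nhdsWithin X (weakTop X) x₀ (Metric.sphere (0 : X) 1))
      (nhdsWithin x₀ (Metric.sphere (0 : X) 1)))
    (hw : ∀ f : X →L[ℝ] ℝ, Tendsto (fun i => f (z i)) l (𝓝 (f x₀)))
    (hn : Tendsto (fun i => ‖z i‖) l (𝓝 1)) :
    Tendsto z l (𝓝 x₀) := by
  have hpos : ∀ᶠ i in l, 0 < ‖z i‖ := hn.eventually (lt_mem_nhds one_pos)
  have hinv : Tendsto (fun i => ‖z i‖⁻¹) l (𝓝 1) := by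
    simpa using hn.inv₀ one_ne_zero
  have hy : Tendsto (fun i => ‖z i‖⁻¹ • z i) l
      (@nhdsWithin X (weakTop X) x₀ (Metric.sphere (0 : X) 1)) := by
    refine tendsto_inf.2 ⟨tendsto_nhds_weakTop fun f => ?_, tendsto_principal.2 ?_⟩
    · simpa using hinv.mul (hw f)
    · filter_upwards [hpos] with i hi
      simp [norm_smul, hi.ne']
  have hy' : Tendsto (fun i => ‖z i‖⁻¹ • z i) l (𝓝 x₀) :=
    tendsto_nhds_of_tendsto_nhdsWithin (hagree.comp hy)
  have hz : Tendsto (fun i => ‖z i‖ • ‖z i‖⁻¹ • z i) l (𝓝 x₀) := by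
    simpa using hn.smul hy'
  refine hz.congr' ?_
  filter_upwards [hpos] with i hi
  exact smul_inv_smul₀ hi.ne' _

/-- If a Banach space `X` has property `M(1,s)` for some `0 < s ≤ 1` and there is a point
`x₀` of the unit sphere at which the relative weak and norm topologies on the sphere agree,
then `X` has the GGLD property. -/
theorem stmt_0 {X : Type*} [NormedAddCommGroup X] [NormedSpace ℝ X] [CompleteSpace X]
    (s : ℝ) (hs0 : 0 < s) (hs1 : s ≤ 1)
    -- property M(1,s): for all bounded weakly null nets
    (hM : ∀ (J : Type) [Preorder J] [IsDirected J (· ≤ ·)] [Nonempty J]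
      (u v : X) (x : J → X), ‖u‖ ≤ ‖v‖ →
      (∃ C : ℝ, ∀ j, ‖x j‖ ≤ C) →
      (∀ f : X →L[ℝ] ℝ, Tendsto (fun j => f (x j)) atTop (𝓝 0)) →
      limsup (fun j => ‖u + s • x j‖) atTop ≤ limsup (fun j => ‖v + x j‖) atTop)
    -- a point of the unit sphere where the relative weak and norm topologies agree
    (x₀ : X) (hx₀ : x₀ ∈ Metric.sphere (0 : X) 1)
    (hagree : Tendsto (id : X → X)
      (@nhdsWithin X (weakTop X) x₀ (Metric.sphere (0 : X) 1))
      (nhdsWithin x₀ (Metric.sphere (0 : X) 1))) :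
    -- GGLD property
    ∀ x : ℕ → X, (∀ f : X →L[ℝ] ℝ, Tendsto (fun n => f (x n)) atTop (𝓝 0)) →
      Tendsto (fun n => ‖x n‖) atTop (𝓝 1) →
      1 < limsup (fun n => limsup (fun m => ‖x n - x m‖) atTop) atTop := by
  intro x hx hx1
  by_contra! hle
  have hx₀n : ‖x₀‖ = 1 := by simpa using hx₀
  obtain ⟨C, hC⟩ : ∃ C : ℝ, ∀ n, ‖x n‖ ≤ C := by
    obtain ⟨C, hC⟩ := hx1.bddAbove_range
    exact ⟨C, fun n => hC ⟨n, rfl⟩⟩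
  have hsub : ∀ n m, ‖x n - x m‖ ≤ C + C := fun n m =>
    (norm_sub_le _ _).trans (add_le_add (hC n) (hC m))
  have hbdd : IsBoundedUnder (· ≤ ·) atTop
      (fun n => limsup (fun m => ‖x n - x m‖) atTop) := by
    refine isBoundedUnder_of ⟨C + C, fun n => ?_⟩
    refine limsup_le_of_le ?_ (Eventually.of_forall (hsub n))
    exact IsBoundedUnder.isCoboundedUnder_le (isBoundedUnder_of ⟨0, fun m => norm_nonneg _⟩)
  have hupper : ∀ ε : ℝ, 0 < ε → ∀ᶠ m in atTop, ‖x₀ - s • x m‖ < 1 + ε := by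
    intro ε hε
    have h1 : ∀ᶠ n in atTop, limsup (fun m => ‖x n - x m‖) atTop < 1 + ε / 2 :=
      eventually_lt_of_limsup_lt (by linarith) hbdd
    have h2 : ∀ᶠ n in atTop, |‖x n‖ - 1| < ε / 2 := by
      simpa [Real.dist_eq] using Metric.tendsto_nhds.1 hx1 (ε / 2) (by linarith)
    obtain ⟨n, hn1, hn2⟩ := (h1.and h2).exists
    have hMn := hM ℕ (‖x n‖ • x₀) (x n) (fun m => -x m) (by simp [norm_smul, hx₀n])
      ⟨C, fun m => by simpa using hC m⟩ (fun f => by simpa using (hx f).neg)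
    simp only [smul_neg, ← sub_eq_add_neg] at hMn
    have hb : IsBoundedUnder (· ≤ ·) atTop (fun m => ‖‖x n‖ • x₀ - s • x m‖) := by
      refine isBoundedUnder_of ⟨‖x n‖ + s * C, fun m => (norm_sub_le _ _).trans ?_⟩
      simp only [norm_smul, hx₀n, norm_norm, mul_one, Real.norm_of_nonneg hs0.le]
      gcongr
      exact hC m
    filter_upwards [eventually_lt_of_limsup_lt (hMn.trans_lt hn1) hb] with m hm
    have h3 : ‖x₀ - ‖x n‖ • x₀‖ < ε / 2 := by
      rw [show x₀ - ‖x n‖ • x₀ = (1 - ‖x n‖) • x₀ by rw [sub_smul, one_smul], norm_smul, hx₀n,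
        mul_one, Real.norm_eq_abs, abs_sub_comm]
      exact hn2
    have h4 := norm_sub_le_norm_sub_add_norm_sub x₀ (‖x n‖ • x₀) (s • x m)
    linarith
  have hweak : ∀ f : X →L[ℝ] ℝ, Tendsto (fun m => f (x₀ - s • x m)) atTop (𝓝 (f x₀)) := by
    intro f
    simpa using ((hx f).const_mul s).const_sub (f x₀)
  have hnorm : Tendsto (fun m => ‖x₀ - s • x m‖) atTop (𝓝 1) := by
    obtain ⟨f, hf, hfx⟩ := exists_dual_vector ℝ x₀ (norm_ne_zero_iff.1 (by simp [hx₀n]))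
    refine tendsto_order.2 ⟨fun a ha => ?_, fun a ha => ?_⟩
    · have hfx1 : f x₀ = 1 := by simpa [hx₀n] using hfx
      filter_upwards [(hweak f).eventually (lt_mem_nhds (hfx1.symm ▸ ha))] with m hm
      have h1 := f.le_opNorm (x₀ - s • x m)
      rw [hf, one_mul] at h1
      exact hm.trans_le ((le_abs_self _).trans h1)
    · simpa using hupper (a - 1) (by linarith)
  have hstrong := tendsto_of_weak_of_norm hagree hweak hnorm
  have hzero : Tendsto (fun m => ‖x₀ - (x₀ - s • x m)‖) atTop (𝓝 0) := by
    simpa using (hstrong.const_sub x₀).norm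
  have hs : Tendsto (fun m => ‖x₀ - (x₀ - s • x m)‖) atTop (𝓝 s) := by
    simpa [norm_smul, abs_of_pos hs0] using hx1.const_mul s
  exact hs0.ne (tendsto_nhds_unique hzero hs)
end

section
/- Let X be a Banach space satisfying property M(1,s) for some 0 < s ≤ 1, and suppose there exists a point x₀ in the unit sphere S_X at which the relative weak and norm topologies sequentially agree, i.e., every sequence in S_X converging weakly to x₀ converges to x₀ in norm. Then X satisfies the Kadec-Klee property. -/
open Filter Topology

/-- A sequence converging weakly to a unit vector, whose norms have limit superior at most `1`,
has norms converging to `1`. -/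
theorem tendsto_norm_of_weak_of_limsup_le_one {X : Type*} [NormedAddCommGroup X] [NormedSpace ℝ X]
    {z : ℕ → X} {a : X} (ha : ‖a‖ = 1) {C : ℝ} (hC : ∀ n, ‖z n‖ ≤ C)
    (hz : ∀ f : X →L[ℝ] ℝ, Tendsto (fun n => f (z n)) atTop (𝓝 (f a)))
    (hle : limsup (fun n => ‖z n‖) atTop ≤ 1) :
    Tendsto (fun n => ‖z n‖) atTop (𝓝 1) := by
  obtain ⟨f, hf, hfa⟩ := exists_dual_vector ℝ a (by simp [ha])
  have hfa1 : f a = 1 := by simpa [ha] using hfa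
  have hfz : ∀ n, f (z n) ≤ ‖z n‖ := fun n =>
    (le_abs_self _).trans (by simpa [hf] using f.le_opNorm (z n))
  have hlim := hz f
  rw [hfa1] at hlim
  refine tendsto_order.2 ⟨fun b hb => ?_, fun b hb => ?_⟩
  · filter_upwards [hlim.eventually_const_lt hb] with n hn using hn.trans_le (hfz n)
  · exact eventually_lt_of_limsup_lt (hle.trans_lt hb) (isBoundedUnder_of ⟨C, hC⟩)

/-- If the weak and norm topologies of the unit sphere sequentially agree at `a`, then weak
convergence to `a` together with convergence of the norms to `1` gives norm convergence. -/
theorem tendsto_of_weak_of_tendsto_norm {X : Type*} [NormedAddCommGroup X] [NormedSpace ℝ X]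
    {a : X} (ha : a ∈ Metric.sphere (0 : X) 1)
    (hseq : ∀ x : ℕ → X, (∀ n, x n ∈ Metric.sphere (0 : X) 1) →
      (∀ f : X →L[ℝ] ℝ, Tendsto (fun n => f (x n)) atTop (𝓝 (f a))) →
      Tendsto x atTop (𝓝 a))
    {z : ℕ → X} (hz : ∀ f : X →L[ℝ] ℝ, Tendsto (fun n => f (z n)) atTop (𝓝 (f a)))
    (hnorm : Tendsto (fun n => ‖z n‖) atTop (𝓝 1)) :
    Tendsto z atTop (𝓝 a) := by
  classical
  have hne : ∀ᶠ n in atTop, z n ≠ 0 := by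
    filter_upwards [hnorm.eventually_const_lt one_pos] with n hn using norm_pos_iff.1 hn
  let w : ℕ → X := fun n => if z n = 0 then a else ‖z n‖⁻¹ • z n
  have hw : Tendsto w atTop (𝓝 a) := by
    refine hseq w (fun n => ?_) fun f => ?_
    · by_cases h : z n = 0
      · simpa [w, h] using ha
      · simp [w, h, norm_smul]
    · have h : Tendsto (fun n => ‖z n‖⁻¹ * f (z n)) atTop (𝓝 (f a)) := by
        simpa using (hnorm.inv₀ one_ne_zero).mul (hz f)
      refine h.congr' ?_
      filter_upwards [hne] with n hn
      simp [w, hn]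
  have h : Tendsto (fun n => ‖z n‖ • w n) atTop (𝓝 a) := by simpa using hnorm.smul hw
  refine h.congr' ?_
  filter_upwards [hne] with n hn
  simp [w, hn, smul_smul]

/-- If a Banach space `X` has property `M(1,s)` for some `0 < s ≤ 1` and there is a point
`x₀` of the unit sphere at which the relative weak and norm topologies sequentially agree,
then `X` has the Kadec–Klee property. -/
theorem stmt_2 {X : Type*} [NormedAddCommGroup X] [NormedSpace ℝ X] [CompleteSpace X]
    (s : ℝ) (hs0 : 0 < s) (hs1 : s ≤ 1)
    -- property M(1,s): for all bounded weakly null nets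
    (hM : ∀ (J : Type) [Preorder J] [IsDirected J (· ≤ ·)] [Nonempty J]
      (u v : X) (x : J → X), ‖u‖ ≤ ‖v‖ →
      (∃ C : ℝ, ∀ j, ‖x j‖ ≤ C) →
      (∀ f : X →L[ℝ] ℝ, Tendsto (fun j => f (x j)) atTop (𝓝 0)) →
      limsup (fun j => ‖u + s • x j‖) atTop ≤ limsup (fun j => ‖v + x j‖) atTop)
    -- a point of the sphere where the weak and norm topologies sequentially agree
    (x₀ : X) (hx₀ : x₀ ∈ Metric.sphere (0 : X) 1)
    (hseq : ∀ x : ℕ → X, (∀ n, x n ∈ Metric.sphere (0 : X) 1) →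
      (∀ f : X →L[ℝ] ℝ, Tendsto (fun n => f (x n)) atTop (𝓝 (f x₀))) →
      Tendsto x atTop (𝓝 x₀)) :
    -- Kadec–Klee property
    ∀ (x : ℕ → X) (y₀ : X), (∀ n, x n ∈ Metric.sphere (0 : X) 1) →
      y₀ ∈ Metric.sphere (0 : X) 1 →
      (∀ f : X →L[ℝ] ℝ, Tendsto (fun n => f (x n)) atTop (𝓝 (f y₀))) →
      Tendsto x atTop (𝓝 y₀) := by
  intro x y₀ hx hy₀ hweak
  have hx1 : ∀ n, ‖x n‖ = 1 := fun n => mem_sphere_zero_iff_norm.1 (hx n)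
  have hy1 : ‖y₀‖ = 1 := mem_sphere_zero_iff_norm.1 hy₀
  have hx₀1 : ‖x₀‖ = 1 := mem_sphere_zero_iff_norm.1 hx₀
  have hbound : ∀ n, ‖x n - y₀‖ ≤ 2 := fun n => (norm_sub_le _ _).trans (by
    rw [hx1, hy1]; norm_num)
  have hnull : ∀ f : X →L[ℝ] ℝ, Tendsto (fun n => f (x n - y₀)) atTop (𝓝 0) := fun f => by
    simpa using (hweak f).sub_const (f y₀)
  have hlimsup : limsup (fun n => ‖x₀ + s • (x n - y₀)‖) atTop ≤ 1 := by
    simpa [hx1] using hM ℕ x₀ y₀ (fun n => x n - y₀) (by rw [hx₀1, hy1]) ⟨2, hbound⟩ hnull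
  have hzweak : ∀ f : X →L[ℝ] ℝ,
      Tendsto (fun n => f (x₀ + s • (x n - y₀))) atTop (𝓝 (f x₀)) := fun f => by
    simpa only [map_add, map_smul, smul_zero, add_zero] using
      ((hnull f).const_smul s).const_add (f x₀)
  have hzbound : ∀ n, ‖x₀ + s • (x n - y₀)‖ ≤ 1 + s * 2 := fun n => by
    refine (norm_add_le _ _).trans ?_
    rw [hx₀1, norm_smul, Real.norm_of_nonneg hs0.le]
    gcongr
    exact hbound n
  have hz := tendsto_of_weak_of_tendsto_norm hx₀ hseq hzweak
    (tendsto_norm_of_weak_of_limsup_le_one hx₀1 hzbound hzweak hlimsup)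
  simpa [hs0.ne', smul_smul] using ((hz.sub_const x₀).const_smul s⁻¹).add_const y₀
end

section
/- Let X be a Banach space such that for every ε > 0 there exist r, s ∈ (0,1] with (1−r)/s < ε such that X satisfies the (r,s)-LKK* property. Then X* has the sequential UKK* property: for every ε > 0 there exists δ > 0 such that whenever (x*_n) is a sequence in the closed unit ball of X* with sep(x*_n) ≥ ε that converges weak* to some x* ∈ X*, it holds that ‖x*‖ ≤ 1 − δ. -/
open Filter Topology

/-- If for every `ε > 0` a Banach space `X` satisfies the `(r,s)`-LKK* property for some
`r, s ∈ (0,1]` with `(1-r)/s < ε`, then the dual `X*` has the sequential UKK* property. -/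
theorem stmt_4 {X : Type*} [NormedAddCommGroup X] [NormedSpace ℝ X] [CompleteSpace X]
    (h : ∀ ε > (0 : ℝ), ∃ r s : ℝ, r ∈ Set.Ioc (0 : ℝ) 1 ∧ s ∈ Set.Ioc (0 : ℝ) 1 ∧
      (1 - r) / s < ε ∧
      -- X satisfies the (r,s)-LKK* property
      ∀ (f : X →L[ℝ] ℝ) (g : ℕ → X →L[ℝ] ℝ),
        (∀ x : X, Tendsto (fun n => g n x) atTop (𝓝 0)) →
        r * ‖f‖ + s * limsup (fun n => ‖g n‖) atTop ≤ limsup (fun n => ‖f + g n‖) atTop) :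
    -- sequential UKK* property of X*
    ∀ ε > (0 : ℝ), ∃ δ > (0 : ℝ), ∀ (g : ℕ → X →L[ℝ] ℝ) (f : X →L[ℝ] ℝ),
      (∀ n, ‖g n‖ ≤ 1) →
      (∀ n m, n ≠ m → ε ≤ ‖g n - g m‖) →
      (∀ x : X, Tendsto (fun n => g n x) atTop (𝓝 (f x))) →
      ‖f‖ ≤ 1 - δ := by
  intro ε hε
  obtain ⟨r, s, ⟨hr, -⟩, ⟨hs, -⟩, hrs, hX⟩ := h (ε / 2) (half_pos hε)
  rw [div_lt_iff₀ hs] at hrs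
  refine ⟨1 - (1 - s * (ε / 2)) / r, ?_, fun g f hg hsep hlim => ?_⟩
  · rw [gt_iff_lt, sub_pos, div_lt_one hr]
    linarith
  have hnull : ∀ x : X, Tendsto (fun n => (g n - f) x) atTop (𝓝 0) := fun x => by
    simpa using (hlim x).sub_const (f x)
  have hfreq : ∃ᶠ n in atTop, ε / 2 ≤ ‖g n - f‖ := by
    intro hsmall
    obtain ⟨N, hN⟩ := eventually_atTop.1 hsmall
    have h₀ := not_le.1 (hN N le_rfl)
    have h₁ := not_le.1 (hN (N + 1) N.le_succ)
    have h₂ := hsep N (N + 1) N.succ_ne_self.symm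
    have h₃ := norm_sub_le_norm_sub_add_norm_sub (g N) f (g (N + 1))
    rw [norm_sub_rev f] at h₃
    linarith
  have hbdd : IsBoundedUnder (· ≤ ·) atTop (fun n => ‖g n - f‖) :=
    isBoundedUnder_of ⟨1 + ‖f‖, fun n => (norm_sub_le _ _).trans (by gcongr; exact hg n)⟩
  have hlower : ε / 2 ≤ limsup (fun n => ‖g n - f‖) atTop :=
    le_limsup_of_frequently_le hfreq hbdd
  have hupper : limsup (fun n => ‖f + (g n - f)‖) atTop ≤ 1 :=
    limsup_le_of_le (isCoboundedUnder_le_of_le atTop (x := 0) fun n => norm_nonneg _)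
      (Eventually.of_forall fun n => by simpa using hg n)
  have hkey := (hX f (fun n => g n - f) hnull).trans hupper
  have hmul := mul_le_mul_of_nonneg_left hlower hs.le
  rw [sub_sub_cancel, le_div_iff₀ hr]
  linarith
end

section
/- Let X be a Banach space satisfying the (r,s)-LKK* property for some r, s ∈ (0,1], let ε > 0, and let (x*_n) be a sequence in the closed unit ball of X* with sep(x*_n) ≥ ε that converges weak* to some x* ∈ X*. Then ‖x*‖ ≤ (1 − s·ε/2)/r. -/
open Filter Topology

/-- If a Banach space `X` satisfies the `(r,s)`-LKK* property, `ε > 0`, and `(x*_n)` is a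
sequence in the closed unit ball of `X*` with `sep(x*_n) ≥ ε` converging weak* to `x*`,
then `‖x*‖ ≤ (1 - s·ε/2)/r`. -/
theorem stmt_5 {X : Type*} [NormedAddCommGroup X] [NormedSpace ℝ X] [CompleteSpace X]
    (r s : ℝ) (hr : r ∈ Set.Ioc (0 : ℝ) 1) (hs : s ∈ Set.Ioc (0 : ℝ) 1)
    -- X satisfies the (r,s)-LKK* property
    (hLKK : ∀ (f : X →L[ℝ] ℝ) (g : ℕ → X →L[ℝ] ℝ),
      (∀ x : X, Tendsto (fun n => g n x) atTop (𝓝 0)) →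
      r * ‖f‖ + s * limsup (fun n => ‖g n‖) atTop ≤ limsup (fun n => ‖f + g n‖) atTop)
    (ε : ℝ) (hε : 0 < ε)
    (g : ℕ → X →L[ℝ] ℝ) (f : X →L[ℝ] ℝ)
    (hball : ∀ n, ‖g n‖ ≤ 1)
    (hsep : ∀ n m, n ≠ m → ε ≤ ‖g n - g m‖)
    (hconv : ∀ x : X, Tendsto (fun n => g n x) atTop (𝓝 (f x))) :
    ‖f‖ ≤ (1 - s * ε / 2) / r := by
  have hr0 := hr.1
  have key := hLKK f (fun n => g n - f) fun x => by
    simpa using (hconv x).sub_const (f x)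
  have hbound : ∀ n, ‖g n - f‖ ≤ 1 + ‖f‖ := fun n =>
    (norm_sub_le _ _).trans (by linarith [hball n])
  have hlower : ε / 2 ≤ limsup (fun n => ‖g n - f‖) atTop := by
    by_contra! hlt
    obtain ⟨N, hN⟩ := eventually_atTop.1
      (eventually_lt_of_limsup_lt hlt (isBoundedUnder_of ⟨1 + ‖f‖, hbound⟩))
    have hsepN := hsep N (N + 1) (by lia)
    have htri := norm_sub_le_norm_sub_add_norm_sub (g N) f (g (N + 1))
    rw [norm_sub_rev f] at htri
    linarith [hN N le_rfl, hN (N + 1) (by lia)]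
  have hupper : limsup (fun n => ‖f + (g n - f)‖) atTop ≤ 1 := by
    simp only [add_sub_cancel]
    exact limsup_le_of_le (isCoboundedUnder_le_of_le atTop fun n => norm_nonneg (g n))
      (Eventually.of_forall hball)
  rw [le_div_iff₀ hr0]
  linarith [mul_le_mul_of_nonneg_left hlower hs.1.le]
end

section
/- Let X be a Banach space, let K : X → X be a bounded linear operator with adjoint K* : X* → X*, and let r, s > 0. Then for every x* in the closed unit ball of X*, r·‖K*(x*)‖ + s·‖x* − K*(x*)‖ ≤ sup{‖r·K(x) + s·(y − K(y))‖ : x, y in the closed unit ball of X}. -/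
open Filter Topology

theorem ContinuousLinearMap.opNorm_le_of_forall_apply_le {X : Type*} [NormedAddCommGroup X]
    [NormedSpace ℝ X] (g : X →L[ℝ] ℝ) (C : ℝ) (h : ∀ x, ‖x‖ ≤ 1 → g x ≤ C) : ‖g‖ ≤ C := by
  have hC : 0 ≤ C := by simpa using h 0 (by simp)
  refine ContinuousLinearMap.opNorm_le_of_unit_norm hC fun x hx => ?_
  rw [Real.norm_eq_abs, abs_le']
  exact ⟨h x hx.le, by simpa using h (-x) (by simp [hx])⟩

/-- For a bounded linear operator `K` on a Banach space `X`, `r, s > 0` and every `x*` in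
the closed unit ball of `X*`,
`r ‖K* x*‖ + s ‖x* - K* x*‖ ≤ sup_{x, y ∈ B_X} ‖r K x + s (y - K y)‖`. -/
theorem stmt_7 {X : Type*} [NormedAddCommGroup X] [NormedSpace ℝ X] [CompleteSpace X]
    (K : X →L[ℝ] X) (r s : ℝ) (hr : 0 < r) (hs : 0 < s)
    (f : X →L[ℝ] ℝ) (hf : ‖f‖ ≤ 1) :
    r * ‖f.comp K‖ + s * ‖f - f.comp K‖ ≤
      sSup {c : ℝ | ∃ x y : X, ‖x‖ ≤ 1 ∧ ‖y‖ ≤ 1 ∧ c = ‖r • K x + s • (y - K y)‖} := by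
  set A := {c : ℝ | ∃ x y : X, ‖x‖ ≤ 1 ∧ ‖y‖ ≤ 1 ∧ c = ‖r • K x + s • (y - K y)‖}
  have hbdd : BddAbove A := by
    refine ⟨r * ‖K‖ + s * (1 + ‖K‖), ?_⟩
    rintro _ ⟨x, y, hx, hy, rfl⟩
    have hKx : ‖K x‖ ≤ ‖K‖ := K.unit_le_opNorm x hx
    have hKy : ‖K y‖ ≤ ‖K‖ := K.unit_le_opNorm y hy
    calc ‖r • K x + s • (y - K y)‖ ≤ ‖r • K x‖ + ‖s • (y - K y)‖ := norm_add_le _ _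
      _ = r * ‖K x‖ + s * ‖y - K y‖ := by
        rw [norm_smul, norm_smul, Real.norm_of_nonneg hr.le, Real.norm_of_nonneg hs.le]
      _ ≤ r * ‖K‖ + s * (1 + ‖K‖) := by
        gcongr
        exact (norm_sub_le _ _).trans (add_le_add hy hKy)
  have key : ∀ x y : X, ‖x‖ ≤ 1 → ‖y‖ ≤ 1 →
      r * f.comp K x + s * (f - f.comp K) y ≤ sSup A := by
    intro x y hx hy
    calc r * f.comp K x + s * (f - f.comp K) y = f (r • K x + s • (y - K y)) := by simp
      _ ≤ ‖f (r • K x + s • (y - K y))‖ := Real.le_norm_self _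
      _ ≤ 1 * ‖r • K x + s • (y - K y)‖ := f.le_of_opNorm_le hf _
      _ ≤ sSup A := by
        rw [one_mul]
        exact le_csSup hbdd ⟨x, y, hx, hy, rfl⟩
  have hright : ∀ x : X, ‖x‖ ≤ 1 →
      ‖f - f.comp K‖ ≤ (sSup A - r * f.comp K x) / s := fun x hx =>
    ContinuousLinearMap.opNorm_le_of_forall_apply_le _ _ fun y hy => by
      rw [le_div_iff₀ hs]
      linarith [key x y hx hy]
  have hleft : ‖f.comp K‖ ≤ (sSup A - s * ‖f - f.comp K‖) / r :=
    ContinuousLinearMap.opNorm_le_of_forall_apply_le _ _ fun x hx => by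
      have := hright x hx
      rw [le_div_iff₀ hs] at this
      rw [le_div_iff₀ hr]
      linarith
  rw [le_div_iff₀ hr] at hleft
  linarith
end

section
/- Let 1 < p < ∞ and let X = ℂ ⊕_∞ ℓ_p be the direct sum of ℂ and the complex sequence space ℓ_p equipped with the maximum norm ‖(α, x)‖ = max{|α|, ‖x‖_p}. Then X satisfies the (r,s)-LKK* property for all r, s ∈ (0,1] with r^p + s^p ≤ 1. -/
open Filter Topology
open scoped ENNReal

/-- The space `X = ℂ ⊕_∞ ℓ_p` (the product carries the maximum norm). -/
abbrev Xsp (p : ℝ≥0∞) : Type := ℂ × lp (fun _ : ℕ => ℂ) p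

theorem lp.norm_add_rpow_of_disjoint {p : ℝ≥0∞} (hp : 0 < p.toReal)
    (u w : lp (fun _ : ℕ => ℂ) p) (h : ∀ i, u i = 0 ∨ w i = 0) :
    ‖u + w‖ ^ p.toReal = ‖u‖ ^ p.toReal + ‖w‖ ^ p.toReal := by
  refine (lp.hasSum_norm hp (u + w)).unique ?_
  convert (lp.hasSum_norm hp u).add (lp.hasSum_norm hp w) using 2 with i
  rcases h i with h | h <;> simp [h, Real.zero_rpow hp.ne']

theorem lp.norm_smul_add_smul_rpow_le {p : ℝ≥0∞} [Fact (1 ≤ p)] (hp : 0 < p.toReal)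
    {u w : lp (fun _ : ℕ => ℂ) p} (h : ∀ i, u i = 0 ∨ w i = 0) (hu : ‖u‖ ≤ 1) (hw : ‖w‖ ≤ 1)
    (a b : ℂ) :
    ‖a • u + b • w‖ ^ p.toReal ≤ ‖a‖ ^ p.toReal + ‖b‖ ^ p.toReal := by
  rw [lp.norm_add_rpow_of_disjoint hp]
  · rw [norm_smul, norm_smul]
    gcongr
    · exact mul_le_of_le_one_right (norm_nonneg _) hu
    · exact mul_le_of_le_one_right (norm_nonneg _) hw
  · intro i
    rcases h i with h | h <;> simp [h]

/-- The truncation of a sequence in `ℓ_p` to its first `N` coordinates. -/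
noncomputable def lp.truncate {p : ℝ≥0∞} (N : ℕ) (v : lp (fun _ : ℕ => ℂ) p) :
    lp (fun _ : ℕ => ℂ) p :=
  ∑ i ∈ Finset.range N, lp.single p i (v i)

theorem lp.truncate_apply {p : ℝ≥0∞} (N : ℕ) (v : lp (fun _ : ℕ => ℂ) p) (i : ℕ) :
    lp.truncate N v i = if i < N then v i else 0 := by
  rw [lp.truncate, lp.coeFn_sum, Finset.sum_apply]
  simp [Pi.single_apply]

theorem lp.norm_le_of_norm_apply_le {p : ℝ≥0∞} (hp : 0 < p.toReal)
    {v w : lp (fun _ : ℕ => ℂ) p} (h : ∀ i, ‖v i‖ ≤ ‖w i‖) : ‖v‖ ≤ ‖w‖ := by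
  rw [← Real.rpow_le_rpow_iff (lp.norm_nonneg' v) (lp.norm_nonneg' w) hp]
  refine hasSum_le (fun i => ?_) (lp.hasSum_norm hp v) (lp.hasSum_norm hp w)
  gcongr
  exact h i

theorem lp.norm_truncate_le {p : ℝ≥0∞} (hp : 0 < p.toReal) (N : ℕ)
    (v : lp (fun _ : ℕ => ℂ) p) : ‖lp.truncate N v‖ ≤ ‖v‖ := by
  refine lp.norm_le_of_norm_apply_le hp fun i => ?_
  rw [lp.truncate_apply]
  split_ifs <;> simp

theorem lp.norm_sub_truncate_le {p : ℝ≥0∞} (hp : 0 < p.toReal) (N : ℕ)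
    (v : lp (fun _ : ℕ => ℂ) p) : ‖v - lp.truncate N v‖ ≤ ‖v‖ := by
  refine lp.norm_le_of_norm_apply_le hp fun i => ?_
  rw [lp.coeFn_sub, Pi.sub_apply, lp.truncate_apply]
  split_ifs <;> simp

/-- A functional on `ℓ_p`, `1 < p < ∞`, almost attains its norm at a finitely supported vector
and is uniformly small on vectors supported away from it. -/
theorem lp.exists_almost_norming_with_small_tail {p : ℝ≥0∞} [Fact (1 ≤ p)] (hp1 : 1 < p)
    (hp2 : p ≠ ⊤) (φ : lp (fun _ : ℕ => ℂ) p →L[ℂ] ℂ) {ε : ℝ} (hε : 0 < ε) :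
    ∃ (N : ℕ) (u : lp (fun _ : ℕ => ℂ) p), ‖u‖ ≤ 1 ∧ (∀ i, N ≤ i → u i = 0) ∧
      φ u = (‖φ u‖ : ℂ) ∧ ‖φ‖ - ε ≤ ‖φ u‖ ∧
      ∀ w : lp (fun _ : ℕ => ℂ) p, ‖w‖ ≤ 1 → (∀ i, i < N → w i = 0) → ‖φ w‖ ≤ ε := by
  have hq : 1 < p.toReal := by
    rw [← ENNReal.toReal_one]
    exact (ENNReal.toReal_lt_toReal (by simp) hp2).2 hp1
  have hq0 : 0 < p.toReal := by linarith
  obtain ⟨t, ht0, ht⟩ : ∃ t : ℝ, 0 < t ∧ ‖φ‖ * t ^ (p.toReal - 1) < ε / 2 := by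
    have h : Tendsto (fun t : ℝ => ‖φ‖ * t ^ (p.toReal - 1)) (𝓝[>] 0) (𝓝 0) := by
      have := ((Real.continuousAt_rpow_const 0 (p.toReal - 1)
        (Or.inr (by linarith))).tendsto.const_mul ‖φ‖)
      rw [Real.zero_rpow (by linarith), mul_zero] at this
      exact this.mono_left nhdsWithin_le_nhds
    obtain ⟨t, h1, h2⟩ := ((h.eventually (gt_mem_nhds (half_pos hε))).and
      self_mem_nhdsWithin).exists
    exact ⟨t, h2, h1⟩
  set δ := min ε (t * (ε / 2))
  have hδ0 : 0 < δ := by positivity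
  obtain ⟨v, hv1, hv⟩ := φ.exists_lt_apply_of_lt_opNorm (r := ‖φ‖ - δ) (by linarith)
  have hlim : Tendsto (fun N => ‖φ (lp.truncate N v)‖) atTop (𝓝 ‖φ v‖) :=
    ((φ.continuous.tendsto v).comp (lp.hasSum_single hp2 v).tendsto_sum_nat).norm
  obtain ⟨N, hN⟩ := (hlim.eventually (lt_mem_nhds hv)).exists
  obtain ⟨c, hc1, hc⟩ := RCLike.exists_norm_eq_mul_self (φ (lp.truncate N v))
  have hφu : ‖φ (c • lp.truncate N v)‖ = ‖φ (lp.truncate N v)‖ := by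
    rw [map_smul, norm_smul, hc1, one_mul]
  have hu1 : ‖c • lp.truncate N v‖ ≤ 1 := by
    rw [norm_smul, hc1, one_mul]
    exact (lp.norm_truncate_le hq0 N v).trans hv1.le
  have hu2 : ∀ i, N ≤ i → (c • lp.truncate N v) i = 0 := by
    intro i hi
    rw [lp.coeFn_smul, Pi.smul_apply, lp.truncate_apply, if_neg (by omega), smul_zero]
  have hu3 : φ (c • lp.truncate N v) = (‖φ (c • lp.truncate N v)‖ : ℂ) := by
    rw [hφu, map_smul, smul_eq_mul]
    exact hc.symm
  rw [← hφu] at hN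
  generalize c • lp.truncate N v = u at *
  refine ⟨N, u, hu1, hu2, hu3, ?_, fun w hw1 hw2 => ?_⟩
  · linarith [min_le_left ε (t * (ε / 2))]
  · obtain ⟨d, hd1, hd⟩ := RCLike.exists_norm_eq_mul_self (φ w)
    have hn : ‖(1 : ℂ) • u + ((t : ℂ) * d) • w‖ ^ p.toReal ≤ 1 + t ^ p.toReal := by
      refine (lp.norm_smul_add_smul_rpow_le hq0 (fun i => ?_) hu1 hw1 1 (t * d)).trans ?_
      · rcases lt_or_ge i N with hi | hi
        · exact Or.inr (hw2 i hi)
        · exact Or.inl (hu2 i hi)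
      · simp [hd1, abs_of_pos ht0]
    have ht' : 0 < t ^ p.toReal := Real.rpow_pos_of_pos ht0 _
    have hn' : ‖(1 : ℂ) • u + ((t : ℂ) * d) • w‖ ≤ 1 + t ^ p.toReal := by
      by_contra! hlt
      exact absurd (Real.self_le_rpow_of_one_le (by linarith) hq.le) (by linarith)
    have heq : φ ((1 : ℂ) • u + ((t : ℂ) * d) • w) = ((‖φ u‖ + t * ‖φ w‖ : ℝ) : ℂ) := by
      rw [map_add, map_smul, map_smul, one_smul, smul_eq_mul, mul_assoc, ← hd, hu3]
      simp
    have hle := φ.le_opNorm ((1 : ℂ) • u + ((t : ℂ) * d) • w)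
    rw [heq, Complex.norm_real, Real.norm_of_nonneg (by positivity)] at hle
    have hle2 : ‖φ u‖ + t * ‖φ w‖ ≤ ‖φ‖ * (1 + t ^ p.toReal) := hle.trans (by gcongr)
    have hpow : t ^ p.toReal = t * t ^ (p.toReal - 1) := by
      rw [Real.rpow_sub_one ht0.ne']
      field_simp
    have hmul : t * (‖φ‖ * t ^ (p.toReal - 1)) ≤ t * (ε / 2) := by gcongr
    have hδt := min_le_right ε (t * (ε / 2))
    rw [hpow] at hle2
    refine le_of_mul_le_mul_left ?_ ht0
    linarith

/-- A functional on `ℂ ⊕_∞ ℓ_p` has norm at most the sum of the norms of its components. -/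
theorem Xsp.norm_le_add {p : ℝ≥0∞} [Fact (1 ≤ p)] (f : Xsp p →L[ℂ] ℂ) :
    ‖f‖ ≤ ‖f (1, 0)‖ + ‖f.comp (ContinuousLinearMap.inr ℂ ℂ (lp (fun _ : ℕ => ℂ) p))‖ := by
  refine f.opNorm_le_bound (by positivity) fun x => ?_
  have hx : x = x.1 • ((1, 0) : Xsp p) + ContinuousLinearMap.inr ℂ ℂ _ x.2 := by
    ext <;> simp
  calc ‖f x‖ = ‖x.1 • f (1, 0) + f.comp (ContinuousLinearMap.inr ℂ ℂ _) x.2‖ := by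
        conv_lhs => rw [hx, map_add, map_smul]
        rfl
    _ ≤ ‖x.1‖ * ‖f (1, 0)‖ + ‖f.comp (ContinuousLinearMap.inr ℂ ℂ _)‖ * ‖x.2‖ := by
        refine (norm_add_le _ _).trans ?_
        rw [norm_smul]
        gcongr
        exact ContinuousLinearMap.le_opNorm _ _
    _ ≤ ‖x‖ * ‖f (1, 0)‖ + ‖f.comp (ContinuousLinearMap.inr ℂ ℂ _)‖ * ‖x‖ := by
        gcongr
        · exact norm_fst_le x
        · exact norm_snd_le x
    _ = _ := by ring

/-- A functional on `ℂ ⊕_∞ ℓ_p` almost attains its norm, up to its values on the first factor and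
on the first `N` unit vectors, at a vector of `ℓ_p` vanishing on the first `N` coordinates. -/
theorem Xsp.exists_almost_norming_tail {p : ℝ≥0∞} [Fact (1 ≤ p)] (hp : 0 < p.toReal)
    (g : Xsp p →L[ℂ] ℂ) (N : ℕ) {ε : ℝ} (hε : 0 < ε) :
    ∃ w : lp (fun _ : ℕ => ℂ) p, ‖w‖ ≤ 1 ∧ (∀ i, i < N → w i = 0) ∧
      g (0, w) = (‖g (0, w)‖ : ℂ) ∧
      ‖g‖ - ε - ‖g (1, 0)‖ - ∑ i ∈ Finset.range N, ‖g (0, lp.single p i 1)‖ ≤ ‖g (0, w)‖ := by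
  set ψ := g.comp (ContinuousLinearMap.inr ℂ ℂ (lp (fun _ : ℕ => ℂ) p))
  have hψa : ∀ v, g (0, v) = ψ v := fun v => rfl
  simp only [hψa]
  obtain ⟨v, hv1, hv⟩ := ψ.exists_lt_apply_of_lt_opNorm (r := ‖ψ‖ - ε) (by linarith)
  obtain ⟨c, hc1, hc⟩ := RCLike.exists_norm_eq_mul_self (ψ (v - lp.truncate N v))
  have hn : ‖ψ (c • (v - lp.truncate N v))‖ = ‖ψ (v - lp.truncate N v)‖ := by
    rw [map_smul, norm_smul, hc1, one_mul]
  refine ⟨c • (v - lp.truncate N v), ?_, fun i hi => ?_, ?_, ?_⟩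
  · rw [norm_smul, hc1, one_mul]
    exact (lp.norm_sub_truncate_le hp N v).trans hv1.le
  · rw [lp.coeFn_smul, Pi.smul_apply, lp.coeFn_sub, Pi.sub_apply, lp.truncate_apply, if_pos hi,
      sub_self, smul_zero]
  · rw [hn, map_smul, smul_eq_mul]
    exact hc.symm
  · have htr : ‖ψ (lp.truncate N v)‖ ≤ ∑ i ∈ Finset.range N, ‖ψ (lp.single p i 1)‖ := by
      rw [lp.truncate, map_sum]
      refine norm_sum_le_of_le _ fun i _ => ?_
      have : lp.single (E := fun _ : ℕ => ℂ) p i (v i) = v i • lp.single p i (1 : ℂ) := by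
        rw [← lp.single_smul, smul_eq_mul, mul_one]
      rw [this, map_smul, norm_smul]
      refine mul_le_of_le_one_left (norm_nonneg _) ?_
      exact (lp.norm_apply_le_norm (ENNReal.toReal_pos_iff.1 hp).1.ne' v i).trans hv1.le
    have hsub : ‖ψ v‖ ≤ ‖ψ (v - lp.truncate N v)‖ + ‖ψ (lp.truncate N v)‖ := by
      rw [map_sub]
      exact norm_le_norm_sub_add _ _
    have := Xsp.norm_le_add g
    rw [hn]
    linarith

theorem Xsp.eventually_le_norm_add (p : ℝ≥0∞) [Fact (1 ≤ p)] (hp1 : 1 < p) (hp2 : p ≠ ⊤)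
    {r s : ℝ} (hr : r ∈ Set.Ioc (0 : ℝ) 1) (hs : s ∈ Set.Ioc (0 : ℝ) 1)
    (hrs : r ^ p.toReal + s ^ p.toReal ≤ 1) (f : Xsp p →L[ℂ] ℂ) {g : ℕ → Xsp p →L[ℂ] ℂ}
    (hg : ∀ x : Xsp p, Tendsto (fun n => g n x) atTop (𝓝 0)) {ε : ℝ} (hε : 0 < ε) :
    ∀ᶠ n in atTop, r * ‖f‖ + s * ‖g n‖ - ε ≤ ‖f + g n‖ := by
  obtain ⟨hr0, hr1⟩ := hr
  obtain ⟨hs0, hs1⟩ := hs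
  have hp : 0 < p.toReal := ENNReal.toReal_pos (by positivity) hp2
  set η := ε / 4 with hη
  have hη0 : 0 < η := by positivity
  obtain ⟨N, u, hu1, hu2, hu3, hu4, hu5⟩ := lp.exists_almost_norming_with_small_tail hp1 hp2
    (f.comp (ContinuousLinearMap.inr ℂ ℂ _)) hη0
  have hfa : ∀ v, f.comp (ContinuousLinearMap.inr ℂ ℂ _) v = f (0, v) := fun v => rfl
  simp only [hfa] at hu3 hu4 hu5
  obtain ⟨α, hα1, hα⟩ := RCLike.exists_norm_eq_mul_self (f (1, 0))
  have hsmall : Tendsto (fun n => ‖g n (α, (r : ℂ) • u)‖ + (‖g n (1, 0)‖ +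
      ∑ i ∈ Finset.range N, ‖g n (0, lp.single p i 1)‖)) atTop (𝓝 0) := by
    have h := (hg (α, (r : ℂ) • u)).norm.add ((hg (1, 0)).norm.add
      (tendsto_finsetSum (Finset.range N) fun i _ => (hg (0, lp.single p i 1)).norm))
    simpa using h
  filter_upwards [hsmall.eventually (gt_mem_nhds hη0)] with n hn
  obtain ⟨w, hw1, hw2, hw3, hw4⟩ := Xsp.exists_almost_norming_tail hp (g n) N hη0
  have hfw := hu5 w hw1 hw2
  have hnorm : ‖((α, (r : ℂ) • u + (s : ℂ) • w) : Xsp p)‖ ≤ 1 := by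
    rw [Prod.norm_def, max_le_iff]
    refine ⟨hα1.le, ?_⟩
    have h := lp.norm_smul_add_smul_rpow_le hp (fun i => ?_) hu1 hw1 (r : ℂ) (s : ℂ)
    · rw [Complex.norm_real, Complex.norm_real, Real.norm_of_nonneg hr0.le,
        Real.norm_of_nonneg hs0.le] at h
      rw [← Real.rpow_le_rpow_iff (norm_nonneg _) zero_le_one hp, Real.one_rpow]
      exact h.trans hrs
    · rcases lt_or_ge i N with hi | hi
      · exact Or.inr (hw2 i hi)
      · exact Or.inl (hu2 i hi)
  have hle := (f + g n).unit_le_opNorm _ hnorm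
  have hdec : (f + g n) (α, (r : ℂ) • u + (s : ℂ) • w) =
      ((‖f (1, 0)‖ + r * ‖f (0, u)‖ + s * ‖g n (0, w)‖ : ℝ) : ℂ) +
        ((s : ℂ) * f (0, w) + g n (α, (r : ℂ) • u)) := by
    have h1 : ((α, (r : ℂ) • u + (s : ℂ) • w) : Xsp p) =
        (α, (r : ℂ) • u) + (s : ℂ) • ((0, w) : Xsp p) := by ext <;> simp
    have h2 : ((α, (r : ℂ) • u) : Xsp p) =
        α • ((1, 0) : Xsp p) + (r : ℂ) • ((0, u) : Xsp p) := by ext <;> simp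
    have h3 : f (α, (r : ℂ) • u) = (‖f (1, 0)‖ : ℂ) + r * ‖f (0, u)‖ := by
      rw [h2, map_add, map_smul, map_smul, smul_eq_mul, smul_eq_mul, ← hu3]
      congr 1
      exact hα.symm
    rw [h1, map_add, map_smul, add_apply, add_apply, h3,
      smul_eq_mul, mul_add, hw3]
    push_cast
    simp only [Complex.norm_real, norm_norm]
    ring
  rw [hdec] at hle
  have hlow : ‖f (1, 0)‖ + r * ‖f (0, u)‖ + s * ‖g n (0, w)‖ -
      (s * ‖f (0, w)‖ + ‖g n (α, (r : ℂ) • u)‖) ≤ ‖f + g n‖ := by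
    refine le_trans ?_ hle
    refine le_trans ?_ (norm_sub_le_norm_add _ _)
    rw [Complex.norm_real, Real.norm_of_nonneg (by positivity)]
    gcongr
    refine (norm_add_le _ _).trans ?_
    rw [norm_mul, Complex.norm_real, Real.norm_of_nonneg hs0.le]
  have hfn := Xsp.norm_le_add f
  have e1 : r * ‖f‖ ≤ ‖f (1, 0)‖ + r * ‖f (0, u)‖ + η := by
    have i1 : r * ‖f (1, 0)‖ ≤ ‖f (1, 0)‖ := mul_le_of_le_one_left (norm_nonneg _) hr1
    have i2 : r * η ≤ η := mul_le_of_le_one_left hη0.le hr1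
    have i3 : r * ‖f‖ ≤ r * (‖f (1, 0)‖ + (‖f (0, u)‖ + η)) := by
      gcongr
      linarith
    linarith
  have e2 : s * ‖f (0, w)‖ ≤ η :=
    (mul_le_of_le_one_left (norm_nonneg _) hs1).trans hfw
  set σ := ‖g n (1, 0)‖ + ∑ i ∈ Finset.range N, ‖g n (0, lp.single p i 1)‖
  have hσ0 : 0 ≤ σ := by positivity
  have e3 : s * ‖g n‖ ≤ s * ‖g n (0, w)‖ + η + σ := by
    have i1 : s * (η + σ) ≤ η + σ := mul_le_of_le_one_left (by positivity) hs1
    have i2 : s * ‖g n‖ ≤ s * (‖g n (0, w)‖ + (η + σ)) := by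
      gcongr
      linarith
    linarith
  linarith

/-- `X = ℂ ⊕_∞ ℓ_p`, `1 < p < ∞`, satisfies the `(r,s)`-LKK* property for all
`r, s ∈ (0,1]` with `r^p + s^p ≤ 1`. -/
theorem stmt_9 (p : ℝ≥0∞) [Fact (1 ≤ p)] (hp1 : 1 < p) (hp2 : p ≠ ⊤)
    (r s : ℝ) (hr : r ∈ Set.Ioc (0 : ℝ) 1) (hs : s ∈ Set.Ioc (0 : ℝ) 1)
    (hrs : r ^ p.toReal + s ^ p.toReal ≤ 1) :
    -- X satisfies the (r,s)-LKK* property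
    ∀ (f : Xsp p →L[ℂ] ℂ) (g : ℕ → Xsp p →L[ℂ] ℂ),
      (∀ x : Xsp p, Tendsto (fun n => g n x) atTop (𝓝 0)) →
      r * ‖f‖ + s * limsup (fun n => ‖g n‖) atTop ≤ limsup (fun n => ‖f + g n‖) atTop := by
  intro f g hg
  obtain ⟨C, hC⟩ : ∃ C, ∀ n, ‖g n‖ ≤ C := by
    refine banach_steinhaus fun x => ?_
    obtain ⟨C, hC⟩ := (hg x).norm.bddAbove_range
    exact ⟨C, fun n => hC ⟨n, rfl⟩⟩
  have hs0 := hs.1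
  refine le_of_forall_pos_le_add fun ε hε => ?_
  have hbdd : IsBoundedUnder (· ≤ ·) atTop (fun n => ‖f + g n‖) :=
    isBoundedUnder_of ⟨‖f‖ + C, fun n => (norm_add_le _ _).trans (by gcongr; exact hC n)⟩
  have hlt := eventually_lt_of_limsup_lt
    (lt_add_of_pos_right (limsup (fun n => ‖f + g n‖) atTop) (half_pos hε)) hbdd
  have hsup : limsup (fun n => ‖g n‖) atTop ≤
      (limsup (fun n => ‖f + g n‖) atTop + ε - r * ‖f‖) / s := by
    refine limsup_le_of_le (isCoboundedUnder_le_of_le atTop fun n => norm_nonneg (g n)) ?_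
    filter_upwards [hlt, Xsp.eventually_le_norm_add p hp1 hp2 hr hs hrs f hg (half_pos hε)]
      with n h1 h2
    rw [le_div_iff₀ hs0]
    linarith
  rw [le_div_iff₀ hs0] at hsup
  linarith
end

section
/- Let 1 < p < ∞ and let X = ℂ ⊕_∞ ℓ_p be the direct sum of ℂ and the complex sequence space ℓ_p equipped with the maximum norm ‖(α, x)‖ = max{|α|, ‖x‖_p}. Then X fails property M(1,s) for every 0 < s ≤ 1. -/
open Filter Topology
open scoped ENNReal

/-- A finite sum of unimodular multiples of the unit vectors of `ℓ_p` has norm `|S| ^ (1 / p)`. -/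
lemma norm_sum_single_rpow_eq_card (p : ℝ≥0∞) [Fact (1 ≤ p)] (hp : 0 < p.toReal)
    (c : ℕ → ℂ) (hc : ∀ i, ‖c i‖ = 1) (S : Finset ℕ) :
    ‖∑ i ∈ S, lp.single (E := fun _ : ℕ => ℂ) p i (c i)‖ ^ p.toReal = S.card := by
  rw [lp.norm_sum_single hp]
  simp [hc]

/-- The unit vector basis of `ℓ_p`, `1 < p < ∞`, is weakly null. -/
lemma tendsto_apply_single (p : ℝ≥0∞) [Fact (1 ≤ p)] (hp1 : 1 < p) (hp2 : p ≠ ⊤)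
    (g : lp (fun _ : ℕ => ℂ) p →L[ℂ] ℂ) :
    Tendsto (fun j => g (lp.single p j (1 : ℂ))) atTop (𝓝 0) := by
  have hq1 : 1 < p.toReal := by
    simpa using (ENNReal.toReal_lt_toReal ENNReal.one_ne_top hp2).2 hp1
  have hq0 : 0 < p.toReal := by linarith
  choose c hc hcg using fun j => RCLike.exists_norm_eq_mul_self (g (lp.single p j (1 : ℂ)))
  have hsum : ∀ S : Finset ℕ,
      ∑ i ∈ S, ‖g (lp.single p i (1 : ℂ))‖ ≤ ‖g‖ * (S.card : ℝ) ^ p.toReal⁻¹ := by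
    intro S
    have hnorm : ‖∑ i ∈ S, lp.single (E := fun _ : ℕ => ℂ) p i (c i)‖
        = (S.card : ℝ) ^ p.toReal⁻¹ := by
      rw [← norm_sum_single_rpow_eq_card p hq0 c hc S,
        Real.rpow_rpow_inv (norm_nonneg _) hq0.ne']
    have hg : g (∑ i ∈ S, lp.single (E := fun _ : ℕ => ℂ) p i (c i))
        = ((∑ i ∈ S, ‖g (lp.single p i (1 : ℂ))‖ : ℝ) : ℂ) := by
      rw [map_sum, Complex.ofReal_sum]
      refine Finset.sum_congr rfl fun i _ => ?_
      have : lp.single (E := fun _ : ℕ => ℂ) p i (c i) = c i • lp.single p i (1 : ℂ) := by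
        rw [← lp.single_smul]; simp
      rw [this, map_smul, smul_eq_mul]
      exact (hcg i).symm
    have hle := g.le_opNorm (∑ i ∈ S, lp.single (E := fun _ : ℕ => ℂ) p i (c i))
    rw [hg, hnorm, Complex.norm_real] at hle
    exact (le_abs_self _).trans hle
  rw [← Nat.cofinite_eq_atTop, Metric.tendsto_nhds]
  intro ε hε
  rw [Filter.eventually_cofinite]
  by_contra hinf
  have hexp : 0 < 1 - p.toReal⁻¹ := sub_pos.2 (inv_lt_one_of_one_lt₀ hq1)
  have htop : Tendsto (fun n : ℕ => (n : ℝ) ^ (1 - p.toReal⁻¹)) atTop atTop :=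
    (tendsto_rpow_atTop hexp).comp tendsto_natCast_atTop_atTop
  obtain ⟨n, hn, hn0⟩ := ((htop.eventually_gt_atTop (‖g‖ / ε)).and (eventually_gt_atTop 0)).exists
  obtain ⟨S, hS, hcard⟩ := Set.Infinite.exists_subset_card_eq hinf n
  have hn0' : (0 : ℝ) < n := by exact_mod_cast hn0
  have hlow : (n : ℝ) * ε ≤ ∑ i ∈ S, ‖g (lp.single p i (1 : ℂ))‖ := by
    rw [← hcard, ← nsmul_eq_mul]
    refine Finset.card_nsmul_le_sum _ _ _ fun i hi => ?_
    simpa using hS hi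
  have hup := hlow.trans (hsum S)
  rw [hcard] at hup
  rw [div_lt_iff₀ hε] at hn
  have hsplit : (n : ℝ) = (n : ℝ) ^ (1 - p.toReal⁻¹) * (n : ℝ) ^ p.toReal⁻¹ := by
    rw [← Real.rpow_add hn0']; simp
  have hpos : 0 < (n : ℝ) ^ p.toReal⁻¹ := Real.rpow_pos_of_pos hn0' _
  have := mul_lt_mul_of_pos_right hn hpos
  have heq : (n : ℝ) ^ (1 - p.toReal⁻¹) * ε * (n : ℝ) ^ p.toReal⁻¹ = n * ε := by
    nth_rewrite 3 [hsplit]; ring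
  linarith

/-- `‖e₀ + s e_{j+1}‖ ^ p = 1 + s ^ p` in `ℓ_p`. -/
lemma norm_single_add_smul_single_rpow (p : ℝ≥0∞) [Fact (1 ≤ p)] (hp : 0 < p.toReal)
    {s : ℝ} (hs : 0 < s) (j : ℕ) :
    ‖lp.single (E := fun _ : ℕ => ℂ) p 0 (1 : ℂ) + s • lp.single p (j + 1) (1 : ℂ)‖ ^ p.toReal
      = 1 + s ^ p.toReal := by
  have h := lp.norm_sum_single (E := fun _ : ℕ => ℂ) hp
    (fun i => if i = 0 then (1 : ℂ) else (s : ℂ)) {0, j + 1}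
  rw [Finset.sum_pair (by omega), Finset.sum_pair (by omega)] at h
  have hsmul : s • lp.single (E := fun _ : ℕ => ℂ) p (j + 1) (1 : ℂ)
      = lp.single p (j + 1) (s : ℂ) := by
    rw [← lp.single_smul]; simp
  rw [hsmul]
  simpa [abs_of_pos hs] using h

/-- `X = ℂ ⊕_∞ ℓ_p`, `1 < p < ∞`, fails property `M(1,s)` for every `0 < s ≤ 1`. -/
theorem stmt_11 (p : ℝ≥0∞) [Fact (1 ≤ p)] (hp1 : 1 < p) (hp2 : p ≠ ⊤) :
    ∀ s : ℝ, 0 < s → s ≤ 1 →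
      -- X fails property M(1,s)
      ¬ (∀ (J : Type) [Preorder J] [IsDirected J (· ≤ ·)] [Nonempty J]
          (u v : Xsp p) (x : J → Xsp p), ‖u‖ ≤ ‖v‖ →
          (∃ C : ℝ, ∀ j, ‖x j‖ ≤ C) →
          (∀ f : Xsp p →L[ℂ] ℂ, Tendsto (fun j => f (x j)) atTop (𝓝 0)) →
          limsup (fun j => ‖u + s • x j‖) atTop ≤ limsup (fun j => ‖v + x j‖) atTop) := by
  intro s hs _ hM
  have hp0 : 0 < p := zero_lt_one.trans hp1
  have hq0 : 0 < p.toReal := ENNReal.toReal_pos hp0.ne' hp2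
  have hunit : ∀ j, ‖lp.single (E := fun _ : ℕ => ℂ) p j (1 : ℂ)‖ = 1 := fun j => by
    rw [lp.norm_single hp0]; simp
  have h := hM ℕ (0, lp.single p 0 (1 : ℂ)) (1, 0) (fun j => (0, lp.single p (j + 1) (1 : ℂ)))
    (by simp [Prod.norm_def, hunit]) ⟨1, fun j => by simp [Prod.norm_def, hunit]⟩
    (fun f => ((tendsto_apply_single p hp1 hp2
      (f.comp (ContinuousLinearMap.inr ℂ ℂ (lp (fun _ : ℕ => ℂ) p)))).comp
        (tendsto_add_atTop_nat 1)))
  have hleft : ∀ j : ℕ, ‖((0, lp.single p 0 (1 : ℂ)) : Xsp p)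
      + s • ((0, lp.single p (j + 1) (1 : ℂ)) : Xsp p)‖
      = (1 + s ^ p.toReal) ^ p.toReal⁻¹ := fun j => by
    rw [← norm_single_add_smul_single_rpow p hq0 hs j,
      Real.rpow_rpow_inv (norm_nonneg _) hq0.ne']
    simp [Prod.norm_def]
  have hright : ∀ j : ℕ, ‖((1, 0) : Xsp p) + ((0, lp.single p (j + 1) (1 : ℂ)) : Xsp p)‖ = 1 :=
    fun j => by simp [Prod.norm_def, hunit]
  simp only [hleft, hright, limsup_const] at h
  have hlt : 1 < (1 + s ^ p.toReal) ^ p.toReal⁻¹ :=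
    Real.one_lt_rpow (by linarith [Real.rpow_pos_of_pos hs p.toReal]) (inv_pos.2 hq0)
  linarith
end

section
/- Let (α_n) be a sequence of positive real numbers with α₁ ≠ α₂ and Σ_{n=1}^∞ α_n = a ∈ (0,1), and let X be the Banach space of complex (or real) sequences converging to zero equipped with the norm ‖x‖ := sup{|x_n| + Σ_{j=1}^n α_j·|x_j| : n ∈ ℕ}. Then X does not satisfy property (M), i.e., property M(1,1); in fact, for x = e₁/(1+α₁) and y = e₂/(1+α₂) one has ‖x‖ = ‖y‖ = 1, the canonical basis sequence (e_n) is weakly null, lim_n ‖x + e_n‖ = 1 + α₁/(1+α₁), and lim_n ‖y + e_n‖ = 1 + α₂/(1+α₂). -/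
open Filter Topology

/-- The `k`-th canonical basis vector of `c₀`. -/
noncomputable def e (k : ℕ) : ZeroAtInftyContinuousMap ℕ ℝ where
  toFun := Pi.single k 1
  continuous_toFun := continuous_of_discreteTopology
  zero_at_infty' := by
    rw [Filter.cocompact_eq_cofinite]
    have h : ∀ᶠ m in Filter.cofinite, (Pi.single k (1 : ℝ) : ℕ → ℝ) m = 0 := by
      filter_upwards [Filter.eventually_cofinite_ne k] with m hm
      exact Pi.single_eq_of_ne hm 1
    have h' : (Pi.single k (1 : ℝ) : ℕ → ℝ) =ᶠ[Filter.cofinite] (fun _ => (0 : ℝ)) := h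
    exact Filter.Tendsto.congr' h'.symm tendsto_const_nhds

lemma e_apply (k m : ℕ) : e k m = if m = k then 1 else 0 := by
  change (Pi.single k (1 : ℝ) : ℕ → ℝ) m = _
  rw [Pi.single_apply]

lemma tendsto_apply_e (f : ZeroAtInftyContinuousMap ℕ ℝ →L[ℝ] ℝ) :
    Tendsto (fun n => f (e n)) atTop (𝓝 0) := by
  have hs : Summable (fun n => |f (e n)|) := by
    refine summable_of_sum_le (c := ‖f‖) (fun n => abs_nonneg _) fun s => ?_
    set w : ZeroAtInftyContinuousMap ℕ ℝ := ∑ n ∈ s, (SignType.sign (f (e n)) : ℝ) • e n with hw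
    have hwn : ‖w‖ ≤ 1 := by
      rw [← ZeroAtInftyContinuousMap.norm_toBCF_eq_norm]
      refine (BoundedContinuousFunction.norm_le zero_le_one).2 fun m => ?_
      have hm : w m = ∑ n ∈ s, (SignType.sign (f (e n)) : ℝ) * e n m := by
        clear_value w
        subst hw
        induction s using Finset.cons_induction with
        | empty => simp
        | cons b t hb ih =>
          rw [Finset.sum_cons, Finset.sum_cons, ZeroAtInftyContinuousMap.add_apply, ih,
            ZeroAtInftyContinuousMap.smul_apply, smul_eq_mul]
      change |w m| ≤ 1
      simp only [hm, e_apply, mul_ite, mul_one, mul_zero, Finset.sum_ite_eq]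
      split_ifs
      · rcases lt_trichotomy (f (e m)) 0 with h | h | h <;> simp [h]
      · simp
    have hfw : f w = ∑ n ∈ s, |f (e n)| := by
      simp [hw, map_sum, sign_mul_self]
    calc ∑ n ∈ s, |f (e n)| = f w := hfw.symm
      _ ≤ ‖f w‖ := le_abs_self _
      _ ≤ ‖f‖ * ‖w‖ := f.le_opNorm w
      _ ≤ ‖f‖ := mul_le_of_le_one_right (norm_nonneg f) hwn
  exact hs.of_abs.tendsto_atTop_zero

lemma iSup_norm_smul_e {α : ℕ → ℝ} (hα : ∀ n, 0 < α n) {c : ℝ} (hc : 0 ≤ c) (k : ℕ) :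
    ⨆ n : ℕ, (|(c • e k) n| + ∑ j ∈ Finset.range (n + 1), α j * |(c • e k) j|) =
      c * (1 + α k) := by
  have hv (m : ℕ) : |(c • e k) m| = if m = k then c else 0 := by
    rw [ZeroAtInftyContinuousMap.smul_apply, e_apply]
    split_ifs <;> simp [abs_of_nonneg hc]
  have hαc : 0 ≤ α k * c := mul_nonneg (hα k).le hc
  refine IsGreatest.csSup_eq ⟨⟨k, ?_⟩, ?_⟩
  · simp only [hv, mul_ite, mul_zero, Finset.sum_ite_eq', Finset.mem_range]
    simp
    ring
  · rintro _ ⟨m, rfl⟩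
    simp only [hv, mul_ite, mul_zero, Finset.sum_ite_eq', Finset.mem_range]
    split_ifs <;> linarith

lemma iSup_norm_smul_e_add_e {α : ℕ → ℝ} (hα : ∀ n, 0 < α n) {c : ℝ} (hc : 0 ≤ c)
    (hc1 : c ≤ 1) {k l : ℕ} (hkl : k < l) :
    ⨆ n : ℕ, (|(c • e k + e l) n| + ∑ j ∈ Finset.range (n + 1), α j * |(c • e k + e l) j|) =
      1 + c * α k + α l := by
  have hv (m : ℕ) : |(c • e k + e l) m| = (if m = k then c else 0) + if m = l then 1 else 0 := by
    rw [ZeroAtInftyContinuousMap.add_apply, ZeroAtInftyContinuousMap.smul_apply, e_apply, e_apply]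
    split_ifs <;> first | omega | simp [abs_of_nonneg hc]
  have hαc : 0 ≤ α k * c := mul_nonneg (hα k).le hc
  have hl := hα l
  refine IsGreatest.csSup_eq ⟨⟨l, ?_⟩, ?_⟩
  · simp only [hv, mul_add, mul_ite, mul_zero, mul_one, Finset.sum_add_distrib,
      Finset.sum_ite_eq', Finset.mem_range]
    simp [hkl.ne', hkl.trans (Nat.lt_succ_self l)]
    ring
  · rintro _ ⟨m, rfl⟩
    simp only [hv, mul_add, mul_ite, mul_zero, mul_one, Finset.sum_add_distrib,
      Finset.sum_ite_eq', Finset.mem_range]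
    split_ifs <;> first | omega | linarith

/-- Failure of property `(M)` for `c₀` with the norm
`‖x‖ = sup_n (|x_n| + ∑_{j≤n} α_j |x_j|)`, where `∑ α_n = a ∈ (0,1)` and `α₀ ≠ α₁`,
witnessed by `x = e₀/(1+α₀)`, `y = e₁/(1+α₁)` and the weakly null sequence `(e_n)`. -/
theorem stmt_12 (α : ℕ → ℝ) (hα : ∀ n, 0 < α n) (a : ℝ) (hsum : HasSum α a)
    (ha : a ∈ Set.Ioo (0 : ℝ) 1) (hne : α 0 ≠ α 1) :
    -- the norm of the space X
    let N : ZeroAtInftyContinuousMap ℕ ℝ → ℝ :=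
      fun x => ⨆ n : ℕ, (|x n| + ∑ j ∈ Finset.range (n + 1), α j * |x j|)
    let x : ZeroAtInftyContinuousMap ℕ ℝ := (1 + α 0)⁻¹ • e 0
    let y : ZeroAtInftyContinuousMap ℕ ℝ := (1 + α 1)⁻¹ • e 1
    -- X does not satisfy property (M) = M(1,1)
    (¬ ∀ (J : Type) [Preorder J] [IsDirected J (· ≤ ·)] [Nonempty J]
        (u v : ZeroAtInftyContinuousMap ℕ ℝ) (z : J → ZeroAtInftyContinuousMap ℕ ℝ),
        N u ≤ N v → (∃ C : ℝ, ∀ j, N (z j) ≤ C) →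
        (∀ f : ZeroAtInftyContinuousMap ℕ ℝ →L[ℝ] ℝ,
          Tendsto (fun j => f (z j)) atTop (𝓝 0)) →
        limsup (fun j => N (u + z j)) atTop ≤ limsup (fun j => N (v + z j)) atTop) ∧
    -- in fact:
    N x = 1 ∧ N y = 1 ∧
    (∀ f : ZeroAtInftyContinuousMap ℕ ℝ →L[ℝ] ℝ,
      Tendsto (fun n => f (e n)) atTop (𝓝 0)) ∧
    Tendsto (fun n => N (x + e n)) atTop (𝓝 (1 + α 0 / (1 + α 0))) ∧
    Tendsto (fun n => N (y + e n)) atTop (𝓝 (1 + α 1 / (1 + α 1))) := by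
  intro N x y
  have hpos (k : ℕ) : 0 < 1 + α k := by linarith [hα k]
  have hN (k : ℕ) : N ((1 + α k)⁻¹ • e k) = 1 :=
    (iSup_norm_smul_e hα (inv_nonneg.2 (hpos k).le) k).trans (inv_mul_cancel₀ (hpos k).ne')
  have hlim (k : ℕ) : Tendsto (fun n => N ((1 + α k)⁻¹ • e k + e n)) atTop
      (𝓝 (1 + α k / (1 + α k))) := by
    have h := hsum.summable.tendsto_atTop_zero.const_add (1 + (1 + α k)⁻¹ * α k)
    rw [add_zero, mul_comm, ← div_eq_mul_inv] at h
    refine h.congr' ?_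
    filter_upwards [eventually_gt_atTop k] with n hn
    rw [div_eq_mul_inv, mul_comm (α k)]
    exact (iSup_norm_smul_e_add_e hα (inv_nonneg.2 (hpos k).le)
      (inv_le_one_of_one_le₀ (by linarith [hα k])) hn).symm
  refine ⟨fun hM => hne ?_, hN 0, hN 1, tendsto_apply_e, hlim 0, hlim 1⟩
  have hbdd : ∃ C : ℝ, ∀ j, N (e j) ≤ C := by
    refine ⟨1 + a, fun j => ?_⟩
    have h : N ((1 : ℝ) • e j) = 1 * (1 + α j) := iSup_norm_smul_e hα zero_le_one j
    rw [one_smul, one_mul] at h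
    rw [h]
    linarith [le_hasSum hsum j fun i _ => (hα i).le]
  have hle (k l : ℕ) : α k ≤ α l := by
    have h := hM ℕ _ _ e ((hN k).trans (hN l).symm).le hbdd tendsto_apply_e
    rw [(hlim k).limsup_eq, (hlim l).limsup_eq, add_le_add_iff_left,
      div_le_div_iff₀ (hpos k) (hpos l)] at h
    linarith
  exact le_antisymm (hle 0 1) (hle 1 0)
end

section
/- Let 0 < λ < 1 and let X be the Banach space ℂ × c₀ equipped with the norm ‖(α, x)‖ := max{|α| + λ·‖x‖_∞, ‖x‖_∞}, where ‖·‖_∞ is the supremum norm on c₀. Then X does not satisfy property M(1,s) for any 0 < s ≤ 1; in fact, for u = (1, 0) and v = (0, e₁) one has ‖u‖ = ‖v‖ = 1, the sequence ((0, e_n))_{n≥2} is weakly null, ‖u + s·(0, e_n)‖ = 1 + λ·s and ‖v + (0, e_n)‖ = 1 for every n ≥ 2. -/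
open Filter Topology

/-- The `k`-th canonical basis vector of the complex space `c₀`. -/
noncomputable def eC (k : ℕ) : ZeroAtInftyContinuousMap ℕ ℂ where
  toFun := Pi.single k 1
  continuous_toFun := continuous_of_discreteTopology
  zero_at_infty' := by
    rw [Filter.cocompact_eq_cofinite]
    have h : ∀ᶠ m in Filter.cofinite, (Pi.single k (1 : ℂ) : ℕ → ℂ) m = 0 := by
      filter_upwards [Filter.eventually_cofinite_ne k] with m hm
      exact Pi.single_eq_of_ne hm 1
    have h' : (Pi.single k (1 : ℂ) : ℕ → ℂ) =ᶠ[Filter.cofinite] (fun _ => (0 : ℂ)) := h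
    exact Filter.Tendsto.congr' h'.symm tendsto_const_nhds

theorem eC_apply (k m : ℕ) : eC k m = if m = k then 1 else 0 :=
  Pi.single_apply k 1 m

theorem ZeroAtInftyContinuousMap.norm_le_of_forall {g : ZeroAtInftyContinuousMap ℕ ℂ} {C : ℝ}
    (hC : 0 ≤ C) (h : ∀ m, ‖g m‖ ≤ C) : ‖g‖ ≤ C := by
  rw [← ZeroAtInftyContinuousMap.norm_toBCF_eq_norm]
  exact (BoundedContinuousFunction.norm_le hC).2 h

theorem ZeroAtInftyContinuousMap.norm_apply_le (g : ZeroAtInftyContinuousMap ℕ ℂ) (m : ℕ) :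
    ‖g m‖ ≤ ‖g‖ := by
  rw [← ZeroAtInftyContinuousMap.norm_toBCF_eq_norm]
  exact g.toBCF.norm_coe_le_norm m

theorem ZeroAtInftyContinuousMap.finset_sum_apply (F : Finset ℕ)
    (g : ℕ → ZeroAtInftyContinuousMap ℕ ℂ) (m : ℕ) :
    (∑ k ∈ F, g k) m = ∑ k ∈ F, g k m := by
  induction F using Finset.induction_on with
  | empty => simp
  | insert a F ha ih => simp [Finset.sum_insert ha, ih]

theorem norm_sum_smul_eC_le (F : Finset ℕ) (c : ℕ → ℂ) (hc : ∀ k, ‖c k‖ ≤ 1) :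
    ‖∑ k ∈ F, c k • eC k‖ ≤ 1 := by
  refine ZeroAtInftyContinuousMap.norm_le_of_forall zero_le_one fun m => ?_
  rw [ZeroAtInftyContinuousMap.finset_sum_apply]
  simp only [ZeroAtInftyContinuousMap.smul_apply, eC_apply, smul_eq_mul, mul_ite, mul_one,
    mul_zero, Finset.sum_ite_eq]
  split_ifs
  · exact hc m
  · simp

theorem norm_eC (k : ℕ) : ‖eC k‖ = 1 := by
  refine le_antisymm (by simpa using norm_sum_smul_eC_le {k} 1 (by simp)) ?_
  simpa [eC_apply] using (eC k).norm_apply_le k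

theorem norm_eC_add_eC {j k : ℕ} (h : j ≠ k) : ‖eC j + eC k‖ = 1 := by
  refine le_antisymm
    (by simpa [Finset.sum_pair h] using norm_sum_smul_eC_le {j, k} 1 (by simp)) ?_
  simpa [eC_apply, h] using (eC j + eC k).norm_apply_le j

theorem norm_real_smul_eC (s : ℝ) (k : ℕ) : ‖s • eC k‖ = |s| := by
  have h : s • eC k = (s : ℂ) • eC k := by
    ext m
    simp
  rw [h, norm_smul, norm_eC, mul_one, Complex.norm_real, Real.norm_eq_abs]

/-- A continuous functional on `c₀` is absolutely summable along the canonical basis. -/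
theorem summable_norm_apply_eC (g : ZeroAtInftyContinuousMap ℕ ℂ →L[ℂ] ℂ) :
    Summable fun n => ‖g (eC n)‖ := by
  refine summable_of_sum_le (c := ‖g‖) (fun _ => norm_nonneg _) fun F => ?_
  let c : ℕ → ℂ := fun k => (starRingEnd ℂ) (g (eC k)) / ‖g (eC k)‖
  have hc : ∀ k, ‖c k‖ ≤ 1 := fun k => by
    simpa [c] using div_self_le_one ‖g (eC k)‖
  have hmul : ∀ k, c k * g (eC k) = ‖g (eC k)‖ := fun k => by
    by_cases h : g (eC k) = 0
    · simp [h]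
    · have h' : (‖g (eC k)‖ : ℂ) ≠ 0 := by simpa using h
      simp only [c]
      rw [div_mul_eq_mul_div, Complex.conj_mul', sq, mul_div_assoc, div_self h', mul_one]
  have hsum : g (∑ k ∈ F, c k • eC k) = ((∑ k ∈ F, ‖g (eC k)‖ : ℝ) : ℂ) := by
    simp [map_sum, hmul]
  calc ∑ k ∈ F, ‖g (eC k)‖ = ‖g (∑ k ∈ F, c k • eC k)‖ := by
        rw [hsum, Complex.norm_real, Real.norm_of_nonneg
          (Finset.sum_nonneg fun _ _ => norm_nonneg _)]
    _ ≤ ‖g‖ * 1 := g.le_opNorm_of_le (norm_sum_smul_eC_le F c hc)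
    _ = ‖g‖ := mul_one _

theorem tendsto_apply_zero_eC (f : (ℂ × ZeroAtInftyContinuousMap ℕ ℂ) →L[ℂ] ℂ) :
    Tendsto (fun n => f ((0 : ℂ), eC n)) atTop (𝓝 0) :=
  tendsto_zero_iff_norm_tendsto_zero.2
    (summable_norm_apply_eC
      (f.comp (ContinuousLinearMap.inr ℂ ℂ (ZeroAtInftyContinuousMap ℕ ℂ)))).tendsto_atTop_zero

/-- The space `X = ℂ × c₀` with the norm `‖(α,x)‖ = max {|α| + λ‖x‖_∞, ‖x‖_∞}`,
`0 < λ < 1`, fails property `M(1,s)` for every `0 < s ≤ 1`; in fact this is witnessed by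
`u = (1,0)`, `v = (0,e₁)` and the weakly null sequence `((0,e_n))_{n ≥ 2}`. -/
theorem stmt_13 (lam : ℝ) (hlam0 : 0 < lam) (hlam1 : lam < 1) :
    -- the norm of the space X
    let N : ℂ × ZeroAtInftyContinuousMap ℕ ℂ → ℝ :=
      fun w => max (‖w.1‖ + lam * ‖w.2‖) ‖w.2‖
    let u : ℂ × ZeroAtInftyContinuousMap ℕ ℂ := (1, 0)
    let v : ℂ × ZeroAtInftyContinuousMap ℕ ℂ := (0, eC 0)
    ∀ s : ℝ, 0 < s → s ≤ 1 →
      -- X does not satisfy property M(1,s)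
      (¬ ∀ (J : Type) [Preorder J] [IsDirected J (· ≤ ·)] [Nonempty J]
          (u' v' : ℂ × ZeroAtInftyContinuousMap ℕ ℂ)
          (z : J → ℂ × ZeroAtInftyContinuousMap ℕ ℂ),
          N u' ≤ N v' → (∃ C : ℝ, ∀ j, N (z j) ≤ C) →
          (∀ f : (ℂ × ZeroAtInftyContinuousMap ℕ ℂ) →L[ℂ] ℂ,
            Tendsto (fun j => f (z j)) atTop (𝓝 0)) →
          limsup (fun j => N (u' + s • z j)) atTop ≤ limsup (fun j => N (v' + z j)) atTop) ∧
      -- in fact: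
      N u = 1 ∧ N v = 1 ∧
      (∀ f : (ℂ × ZeroAtInftyContinuousMap ℕ ℂ) →L[ℂ] ℂ,
        Tendsto (fun n => f ((0 : ℂ), eC n)) atTop (𝓝 0)) ∧
      (∀ n : ℕ, 1 ≤ n → N (u + s • ((0 : ℂ), eC n)) = 1 + lam * s) ∧
      (∀ n : ℕ, 1 ≤ n → N (v + ((0 : ℂ), eC n)) = 1) := by
  intro N u v s hs0 hs1
  have hu : N u = 1 := by simp [N, u]
  have hv : N v = 1 := by simp [N, v, norm_eC, hlam1.le]
  have hus : ∀ n : ℕ, 1 ≤ n → N (u + s • ((0 : ℂ), eC n)) = 1 + lam * s := fun n _ => by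
    have hle : s ≤ 1 + lam * s := by nlinarith
    simp [N, u, norm_real_smul_eC, abs_of_pos hs0, hle]
  have hvs : ∀ n : ℕ, 1 ≤ n → N (v + ((0 : ℂ), eC n)) = 1 := fun n hn => by
    have h0n : 0 ≠ n := by omega
    simp [N, v, norm_eC_add_eC h0n, hlam1.le]
  refine ⟨fun h => ?_, hu, hv, tendsto_apply_zero_eC, hus, hvs⟩
  have key := h ℕ u v (fun n => ((0 : ℂ), eC n)) (hu.trans hv.symm).le
    ⟨1, fun n => by simp [N, norm_eC, hlam1.le]⟩ tendsto_apply_zero_eC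
  rw [limsup_congr ((eventually_ge_atTop 1).mono hus),
    limsup_congr ((eventually_ge_atTop 1).mono hvs), limsup_const, limsup_const] at key
  linarith [mul_pos hlam0 hs0]
end

section
/- Let K be a real Hilbert space and let X = B_ℝ(ℂ, K) be the Banach space of continuous real-linear operators from ℂ (regarded as a real normed space) into K with the operator norm. Then X satisfies the (r,s)-LKK* property for every r, s ∈ (0,1] with r² + s² ≤ 1. -/
open Filter Topology
open scoped InnerProductSpace

/-- A real-linear operator on `ℂ` is determined by its values at `1` and `I`. -/
theorem Complex.clm_eq_smulRight_add {K : Type*} [NormedAddCommGroup K] [NormedSpace ℝ K]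
    (T : ℂ →L[ℝ] K) :
    T = Complex.reCLM.smulRight (T 1) + Complex.imCLM.smulRight (T Complex.I) := by
  ext z
  have hz : z = z.re • (1 : ℂ) + z.im • Complex.I := by
    simp [Complex.re_add_im]
  conv_lhs => rw [hz]
  simp only [map_add, map_smul]
  simp

/-- A functional on `B_ℝ(ℂ, K)` only sees the component of an operator in some
finite-dimensional subspace of `K`. -/
theorem exists_finiteDimensional_apply_starProjection_comp {K : Type*} [NormedAddCommGroup K]
    [InnerProductSpace ℝ K] [CompleteSpace K] (f : (ℂ →L[ℝ] K) →L[ℝ] ℝ) :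
    ∃ (E : Submodule ℝ K) (_ : FiniteDimensional ℝ E),
      ∀ T : ℂ →L[ℝ] K, f (E.starProjection ∘L T) = f T := by
  let col (φ : ℂ →L[ℝ] ℝ) : K :=
    (InnerProductSpace.toDual ℝ K).symm (f ∘L ContinuousLinearMap.smulRightL ℝ ℂ K φ)
  have hcol (φ : ℂ →L[ℝ] ℝ) (x : K) : f (φ.smulRight x) = ⟪col φ, x⟫_ℝ := by
    simp [col]
  have hf (T : ℂ →L[ℝ] K) :
      f T = ⟪col Complex.reCLM, T 1⟫_ℝ + ⟪col Complex.imCLM, T Complex.I⟫_ℝ := by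
    conv_lhs => rw [Complex.clm_eq_smulRight_add T]
    rw [map_add, hcol, hcol]
  let E := Submodule.span ℝ {col Complex.reCLM, col Complex.imCLM}
  have hE : FiniteDimensional ℝ E := FiniteDimensional.span_of_finite ℝ (Set.toFinite _)
  have hP (u x : K) (hu : u ∈ E) : ⟪u, E.starProjection x⟫_ℝ = ⟪u, x⟫_ℝ := by
    rw [← E.inner_starProjection_left_eq_right, E.starProjection_eq_self_iff.2 hu]
  refine ⟨E, hE, fun T => ?_⟩
  rw [hf, hf, ContinuousLinearMap.comp_apply, ContinuousLinearMap.comp_apply,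
    hP _ _ (Submodule.subset_span (by simp)), hP _ _ (Submodule.subset_span (by simp))]

/-- A weak*-null sequence of functionals on `B_ℝ(ℂ, K)` converges to zero uniformly on the
operators of norm at most one with range in a fixed finite-dimensional subspace. -/
theorem exists_tendsto_zero_bound_starProjection_comp {K : Type*} [NormedAddCommGroup K]
    [InnerProductSpace ℝ K] (E : Submodule ℝ K) [FiniteDimensional ℝ E]
    (g : ℕ → (ℂ →L[ℝ] K) →L[ℝ] ℝ)
    (hg : ∀ T : ℂ →L[ℝ] K, Tendsto (fun n => g n T) atTop (𝓝 0)) :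
    ∃ δ : ℕ → ℝ, Tendsto δ atTop (𝓝 0) ∧
      ∀ n (S : ℂ →L[ℝ] K), ‖S‖ ≤ 1 → |g n (E.starProjection ∘L S)| ≤ δ n := by
  let b := stdOrthonormalBasis ℝ E
  refine ⟨fun n => ∑ i, (|g n (Complex.reCLM.smulRight (b i : K))| +
    |g n (Complex.imCLM.smulRight (b i : K))|), ?_, fun n S hS => ?_⟩
  · have h := tendsto_finsetSum (Finset.univ : Finset (Fin (Module.finrank ℝ E))) fun i _ =>
      (hg (Complex.reCLM.smulRight (b i : K))).abs.add
        (hg (Complex.imCLM.smulRight (b i : K))).abs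
    simpa using h
  · have hP (x : K) : E.starProjection x = ∑ i, ⟪(b i : K), x⟫_ℝ • (b i : K) := by
      rw [Submodule.starProjection_apply, b.orthogonalProjectionOnto_apply_eq_sum]
      simp
    have hPS : E.starProjection ∘L S =
        ∑ i, (⟪(b i : K), S 1⟫_ℝ • Complex.reCLM.smulRight (b i : K) +
          ⟪(b i : K), S Complex.I⟫_ℝ • Complex.imCLM.smulRight (b i : K)) := by
      rw [Complex.clm_eq_smulRight_add (E.starProjection ∘L S)]
      ext z
      simp [hP, Finset.smul_sum, Finset.sum_add_distrib, smul_smul, mul_comm]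
    have hc (i) (z : ℂ) (hz : ‖z‖ = 1) : |⟪(b i : K), S z⟫_ℝ| ≤ 1 := by
      have hb : ‖(b i : K)‖ = 1 := b.norm_eq_one i
      calc |⟪(b i : K), S z⟫_ℝ| ≤ ‖(b i : K)‖ * ‖S z‖ := abs_real_inner_le_norm _ _
        _ = ‖S z‖ := by rw [hb, one_mul]
        _ ≤ ‖S‖ * ‖z‖ := S.le_opNorm z
        _ ≤ 1 := by rwa [hz, mul_one]
    rw [hPS, map_sum]
    refine (Finset.abs_sum_le_sum_abs _ _).trans (Finset.sum_le_sum fun i _ => ?_)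
    rw [map_add, map_smul, map_smul, smul_eq_mul, smul_eq_mul]
    refine (abs_add_le _ _).trans (add_le_add ?_ ?_) <;> rw [abs_mul]
    · exact mul_le_of_le_one_left (abs_nonneg _) (hc i 1 (by simp))
    · exact mul_le_of_le_one_left (abs_nonneg _) (hc i Complex.I (by simp))

/-- Operators with orthogonal ranges combine in an `ℓ²` fashion. -/
theorem norm_smul_starProjection_comp_add_le_one {F K : Type*} [NormedAddCommGroup F]
    [NormedSpace ℝ F] [NormedAddCommGroup K] [InnerProductSpace ℝ K] (E : Submodule ℝ K)
    [E.HasOrthogonalProjection] {r s : ℝ} (hrs : r ^ 2 + s ^ 2 ≤ 1) {T S : F →L[ℝ] K}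
    (hT : ‖T‖ ≤ 1) (hS : ‖S‖ ≤ 1) :
    ‖r • (E.starProjection ∘L T) + s • (S - E.starProjection ∘L S)‖ ≤ 1 := by
  refine ContinuousLinearMap.opNorm_le_bound _ zero_le_one fun z => ?_
  rw [one_mul]
  refine (sq_le_sq₀ (norm_nonneg _) (norm_nonneg z)).1 ?_
  have hTz : ‖E.starProjection (T z)‖ ≤ ‖z‖ :=
    (E.norm_starProjection_apply_le _).trans ((T.le_of_opNorm_le hT z).trans_eq (one_mul _))
  have hSz : ‖S z - E.starProjection (S z)‖ ≤ ‖z‖ := by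
    rw [← E.starProjection_orthogonal_val]
    exact (Eᗮ.norm_starProjection_apply_le _).trans
      ((S.le_of_opNorm_le hS z).trans_eq (one_mul _))
  have horth : ⟪r • E.starProjection (T z), s • (S z - E.starProjection (S z))⟫_ℝ = 0 := by
    rw [real_inner_smul_left, real_inner_smul_right,
      real_inner_comm, E.starProjection_inner_eq_zero _ _ (E.starProjection_apply_mem _)]
    simp
  have hadd := norm_add_sq_eq_norm_sq_add_norm_sq_real horth
  have hT2 : ‖E.starProjection (T z)‖ ^ 2 ≤ ‖z‖ ^ 2 := by gcongr
  have hS2 : ‖S z - E.starProjection (S z)‖ ^ 2 ≤ ‖z‖ ^ 2 := by gcongr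
  have happ : (r • (E.starProjection ∘L T) + s • (S - E.starProjection ∘L S)) z =
      r • E.starProjection (T z) + s • (S z - E.starProjection (S z)) := by simp
  rw [happ]
  calc ‖r • E.starProjection (T z) + s • (S z - E.starProjection (S z))‖ ^ 2
      = r ^ 2 * ‖E.starProjection (T z)‖ ^ 2
        + s ^ 2 * ‖S z - E.starProjection (S z)‖ ^ 2 := by
        rw [sq, hadd, norm_smul, norm_smul, ← sq, ← sq, mul_pow, mul_pow, Real.norm_eq_abs,
          Real.norm_eq_abs, sq_abs, sq_abs]
    _ ≤ r ^ 2 * ‖z‖ ^ 2 + s ^ 2 * ‖z‖ ^ 2 := by gcongr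
    _ = (r ^ 2 + s ^ 2) * ‖z‖ ^ 2 := by ring
    _ ≤ ‖z‖ ^ 2 := mul_le_of_le_one_left (sq_nonneg _) hrs

/-- A real functional almost attains its norm on the unit ball, with positive sign. -/
theorem exists_norm_le_one_sub_lt_apply {X : Type*} [NormedAddCommGroup X] [NormedSpace ℝ X]
    (f : X →L[ℝ] ℝ) {ε : ℝ} (hε : 0 < ε) : ∃ x, ‖x‖ ≤ 1 ∧ ‖f‖ - ε < f x := by
  obtain ⟨x, hx, hfx⟩ := f.exists_lt_apply_of_lt_opNorm (sub_lt_self ‖f‖ hε)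
  rcases abs_choice (f x) with h | h
  · exact ⟨x, hx.le, by rwa [Real.norm_eq_abs, h] at hfx⟩
  · exact ⟨-x, by simpa using hx.le, by rwa [Real.norm_eq_abs, h, ← map_neg] at hfx⟩

theorem eventually_mul_norm_add_mul_norm_le {K : Type*} [NormedAddCommGroup K]
    [InnerProductSpace ℝ K] [CompleteSpace K] {r s : ℝ} (hr : r ∈ Set.Ioc (0 : ℝ) 1)
    (hs : s ∈ Set.Ioc (0 : ℝ) 1) (hrs : r ^ 2 + s ^ 2 ≤ 1) (f : (ℂ →L[ℝ] K) →L[ℝ] ℝ)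
    (g : ℕ → (ℂ →L[ℝ] K) →L[ℝ] ℝ)
    (hg : ∀ T : ℂ →L[ℝ] K, Tendsto (fun n => g n T) atTop (𝓝 0)) {ε : ℝ} (hε : 0 < ε) :
    ∀ᶠ n in atTop, r * ‖f‖ + s * ‖g n‖ ≤ ‖f + g n‖ + ε := by
  obtain ⟨E, hE, hfE⟩ := exists_finiteDimensional_apply_starProjection_comp f
  obtain ⟨δ, hδ, hgδ⟩ := exists_tendsto_zero_bound_starProjection_comp E g hg
  have hε4 : 0 < ε / 4 := by positivity
  obtain ⟨T, hT, hfT⟩ := exists_norm_le_one_sub_lt_apply f hε4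
  filter_upwards [hδ.eventually_lt_const hε4] with n hn
  obtain ⟨S, hS, hgS⟩ := exists_norm_le_one_sub_lt_apply (g n) hε4
  have hW := (le_abs_self _).trans (((f + g n).le_of_opNorm_le_of_le le_rfl
    (norm_smul_starProjection_comp_add_le_one E hrs hT hS)))
  have happ : (f + g n) (r • (E.starProjection ∘L T) + s • (S - E.starProjection ∘L S)) =
      r * f T + r * g n (E.starProjection ∘L T) +
        s * (g n S - g n (E.starProjection ∘L S)) := by
    simp only [add_apply, map_add, map_smul, map_sub, hfE, smul_eq_mul]
    ring
  rw [happ, mul_one] at hW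
  have hgT := (abs_le.1 (hgδ n T hT)).1
  have hgS' := (abs_le.1 (hgδ n S hS)).2
  have h₁ : r * (‖f‖ - f T - g n (E.starProjection ∘L T)) ≤ 1 * (ε / 2) :=
    (mul_le_mul_of_nonneg_left (by linarith) hr.1.le).trans
      (mul_le_mul_of_nonneg_right hr.2 (by linarith))
  have h₂ : s * (‖g n‖ - g n S + g n (E.starProjection ∘L S)) ≤ 1 * (ε / 2) :=
    (mul_le_mul_of_nonneg_left (by linarith) hs.1.le).trans
      (mul_le_mul_of_nonneg_right hs.2 (by linarith))
  linarith

/-- For a real Hilbert space `K`, the Banach space `X = B_ℝ(ℂ, K)` of continuous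
real-linear operators from `ℂ` into `K` satisfies the `(r,s)`-LKK* property for all
`r, s ∈ (0,1]` with `r² + s² ≤ 1`. -/
theorem stmt_15 {K : Type*} [NormedAddCommGroup K] [InnerProductSpace ℝ K]
    [CompleteSpace K]
    (r s : ℝ) (hr : r ∈ Set.Ioc (0 : ℝ) 1) (hs : s ∈ Set.Ioc (0 : ℝ) 1)
    (hrs : r ^ 2 + s ^ 2 ≤ 1) :
    -- X = B_ℝ(ℂ, K) satisfies the (r,s)-LKK* property
    ∀ (f : (ℂ →L[ℝ] K) →L[ℝ] ℝ) (g : ℕ → (ℂ →L[ℝ] K) →L[ℝ] ℝ),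
      (∀ T : ℂ →L[ℝ] K, Tendsto (fun n => g n T) atTop (𝓝 0)) →
      r * ‖f‖ + s * limsup (fun n => ‖g n‖) atTop ≤ limsup (fun n => ‖f + g n‖) atTop := by
  intro f g hg
  obtain ⟨C, hC⟩ := banach_steinhaus fun T : ℂ →L[ℝ] K => by
    obtain ⟨M, hM⟩ := (hg T).norm.bddAbove_range
    exact ⟨M, fun n => hM (Set.mem_range_self n)⟩
  have hbdd : IsBoundedUnder (· ≤ ·) atTop fun n => ‖f + g n‖ :=
    isBoundedUnder_of ⟨‖f‖ + C, fun n => (norm_add_le f (g n)).trans (add_le_add_right (hC n) _)⟩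
  have hcobdd : IsCoboundedUnder (· ≤ ·) atTop fun n => ‖g n‖ :=
    IsBoundedUnder.isCoboundedUnder_le (isBoundedUnder_of ⟨0, fun n => norm_nonneg (g n)⟩)
  refine le_of_forall_pos_le_add fun ε hε => ?_
  have hlim : limsup (fun n => ‖g n‖) atTop ≤
      (limsup (fun n => ‖f + g n‖) atTop + ε - r * ‖f‖) / s := by
    refine limsup_le_of_le hcobdd ?_
    filter_upwards [eventually_mul_norm_add_mul_norm_le hr hs hrs f g hg (half_pos hε),
      eventually_lt_of_limsup_lt (lt_add_of_pos_right _ (half_pos hε)) hbdd] with n h₁ h₂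
    rw [le_div_iff₀ hs.1]
    linarith
  rw [le_div_iff₀ hs.1] at hlim
  linarith
end

section
/- Let H₁ and H₂ be real Hilbert spaces and let A = H₁ ⊕₁ H₂ be their direct sum equipped with the ℓ¹-norm ‖(x₁, x₂)‖ = ‖x₁‖ + ‖x₂‖. Then A satisfies the uniform Kadec-Klee property: for every ε > 0 there exists δ > 0 such that every sequence (a_n) in the closed unit ball of A with sep(a_n) ≥ ε that converges weakly to some a ∈ A satisfies ‖a‖ ≤ 1 − δ. (Every real spin factor is isometric to such an ℓ¹-sum, so this establishes the uniform Kadec-Klee property for real spin factors.) -/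
open Filter Topology

/-- If `⟪u n, x⟫ → ‖x‖²`, as happens when `u` converges weakly to `x`, then `‖x‖ ≤ liminf ‖u n‖`. -/
theorem eventually_norm_sub_lt_norm_of_tendsto_inner {H : Type*} [NormedAddCommGroup H]
    [InnerProductSpace ℝ H] {u : ℕ → H} {x : H}
    (h : Tendsto (fun n => inner ℝ x (u n)) atTop (𝓝 (inner ℝ x x))) {η : ℝ} (hη : 0 < η) :
    ∀ᶠ n in atTop, ‖x‖ - η < ‖u n‖ := by
  rcases eq_or_ne x 0 with rfl | hx
  · refine Eventually.of_forall fun n => ?_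
    have := norm_nonneg (u n)
    rw [norm_zero]
    linarith
  · have hx' : 0 < ‖x‖ := norm_pos_iff.mpr hx
    have hlt : ‖x‖ * (‖x‖ - η) < inner ℝ x x := by
      rw [real_inner_self_eq_norm_mul_norm]
      nlinarith
    filter_upwards [h.eventually_const_lt hlt] with n hn
    exact lt_of_mul_lt_mul_left (hn.trans_le (real_inner_le_norm x (u n))) hx'.le

/-- A point whose norm hardly exceeds that of `x`, and whose inner product with `x` is almost
`‖x‖²`, is close to `x`. -/
theorem norm_sub_le_of_norm_le_of_lt_inner {H : Type*} [NormedAddCommGroup H]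
    [InnerProductSpace ℝ H] {u x : H} {δ r : ℝ} (hδ : 0 < δ) (hδ1 : δ ≤ 1) (hr : 0 ≤ r)
    (hδr : 14 * δ ≤ r ^ 2) (hx : ‖x‖ ≤ 2) (hu : ‖u‖ ≤ ‖x‖ + 2 * δ)
    (hux : inner ℝ x x - δ < inner ℝ x u) : ‖u - x‖ ≤ r := by
  refine le_of_sq_le_sq ?_ hr
  rw [norm_sub_sq_real, real_inner_comm]
  rw [real_inner_self_eq_norm_sq] at hux
  have hu2 : ‖u‖ ^ 2 ≤ (‖x‖ + 2 * δ) ^ 2 := pow_le_pow_left₀ (norm_nonneg u) hu 2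
  nlinarith [norm_nonneg x]

/-- For real Hilbert spaces `H₁, H₂`, the space `A = H₁ ⊕₁ H₂` (the product carries the
`ℓ¹`-norm `‖(x₁,x₂)‖ = ‖x₁‖ + ‖x₂‖`) satisfies the uniform Kadec–Klee property.
(Every real spin factor is isometric to such an `ℓ¹`-sum.) -/
theorem stmt_18 {H₁ H₂ : Type*} [NormedAddCommGroup H₁] [InnerProductSpace ℝ H₁]
    [CompleteSpace H₁] [NormedAddCommGroup H₂] [InnerProductSpace ℝ H₂] [CompleteSpace H₂] :
    ∀ ε > (0 : ℝ), ∃ δ > (0 : ℝ),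
      ∀ (a : ℕ → WithLp 1 (H₁ × H₂)) (x : WithLp 1 (H₁ × H₂)),
        (∀ n, ‖a n‖ ≤ 1) →
        (∀ n m, n ≠ m → ε ≤ ‖a n - a m‖) →
        (∀ f : WithLp 1 (H₁ × H₂) →L[ℝ] ℝ, Tendsto (fun n => f (a n)) atTop (𝓝 (f x))) →
        ‖x‖ ≤ 1 - δ := by
  intro ε hε
  obtain ⟨δ, hδ, hδ1, hδε⟩ : ∃ δ : ℝ, 0 < δ ∧ δ ≤ 1 ∧ 14 * δ ≤ (ε / 8) ^ 2 := by
    refine ⟨min 1 (ε ^ 2 / 1024), by positivity, min_le_left _ _, ?_⟩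
    nlinarith [min_le_right 1 (ε ^ 2 / 1024), sq_nonneg ε]
  refine ⟨δ, hδ, fun a x ha hsep hweak => ?_⟩
  by_contra! hx
  have h₁ : Tendsto (fun n => inner ℝ x.fst (a n).fst) atTop (𝓝 (inner ℝ x.fst x.fst)) :=
    hweak ((innerSL ℝ x.fst).comp (WithLp.fstL 1 ℝ H₁ H₂))
  have h₂ : Tendsto (fun n => inner ℝ x.snd (a n).snd) atTop (𝓝 (inner ℝ x.snd x.snd)) :=
    hweak ((innerSL ℝ x.snd).comp (WithLp.sndL 1 ℝ H₁ H₂))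
  have hclose : ∀ᶠ n in atTop, ‖a n - x‖ ≤ ε / 4 := by
    filter_upwards [eventually_norm_sub_lt_norm_of_tendsto_inner h₁ hδ,
      eventually_norm_sub_lt_norm_of_tendsto_inner h₂ hδ,
      h₁.eventually_const_lt (sub_lt_self _ hδ),
      h₂.eventually_const_lt (sub_lt_self _ hδ)] with n hn₁ hn₂ hi₁ hi₂
    have han := ha n
    rw [WithLp.prod_norm_eq_of_L1] at han hx
    have := norm_nonneg (a n).fst
    have := norm_nonneg (a n).snd
    have hd₁ : ‖(a n).fst - x.fst‖ ≤ ε / 8 :=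
      norm_sub_le_of_norm_le_of_lt_inner hδ hδ1 (by positivity) hδε
        (by linarith) (by linarith) hi₁
    have hd₂ : ‖(a n).snd - x.snd‖ ≤ ε / 8 :=
      norm_sub_le_of_norm_le_of_lt_inner hδ hδ1 (by positivity) hδε
        (by linarith) (by linarith) hi₂
    rw [WithLp.prod_norm_eq_of_L1, WithLp.sub_fst, WithLp.sub_snd]
    linarith
  obtain ⟨N, hN⟩ := eventually_atTop.mp hclose
  have hε' := hsep N (N + 1) N.lt_succ_self.ne
  have htri := norm_sub_le_norm_sub_add_norm_sub (a N) x (a (N + 1))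
  rw [norm_sub_rev x] at htri
  linarith [hN N le_rfl, hN (N + 1) N.le_succ]
end

section
/- Let (α_n) be a sequence of positive real numbers with Σ_{n=1}^∞ α_n = a ∈ (0,1), and let X be the Banach space of complex (or real) sequences converging to zero equipped with the norm ‖x‖ := sup{|x_n| + Σ_{j=1}^n α_j·|x_j| : n ∈ ℕ}. Then X satisfies the (1, 1−a)-LKK* property. -/
open Filter Topology

open scoped ZeroAtInfty

/-- The weighted supremum norm `sup_n (|x_n| + ∑_{j≤n} α_j |x_j|)` on `c₀`. -/
noncomputable def weightedNorm (α : ℕ → ℝ) (x : C₀(ℕ, ℝ)) : ℝ :=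
  ⨆ n : ℕ, (|x n| + ∑ j ∈ Finset.range (n + 1), α j * |x j|)

/-- The dual norm on `c₀*` induced by `weightedNorm α`. -/
noncomputable def weightedDualNorm (α : ℕ → ℝ) (f : C₀(ℕ, ℝ) →L[ℝ] ℝ) : ℝ :=
  sSup {c : ℝ | ∃ x : C₀(ℕ, ℝ), weightedNorm α x ≤ 1 ∧ c = |f x|}

/-- The truncation of a null sequence to its first `m` coordinates. -/
noncomputable def truncation (m : ℕ) (x : C₀(ℕ, ℝ)) : C₀(ℕ, ℝ) :=
  ∑ k ∈ Finset.range m, x k • e k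

theorem truncation_apply (m : ℕ) (x : C₀(ℕ, ℝ)) (n : ℕ) :
    truncation m x n = if n < m then x n else 0 := by
  have key : truncation m x n = ∑ k ∈ Finset.range m, x k * (Pi.single k (1 : ℝ) : ℕ → ℝ) n := by
    unfold truncation
    induction m with
    | zero => simp
    | succ m ih =>
      rw [Finset.sum_range_succ, Finset.sum_range_succ, ZeroAtInftyContinuousMap.add_apply, ih,
        ZeroAtInftyContinuousMap.smul_apply]
      rfl
  rw [key]
  simp [Pi.single_apply]

theorem abs_apply_le_norm (x : C₀(ℕ, ℝ)) (n : ℕ) : |x n| ≤ ‖x‖ := by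
  rw [← ZeroAtInftyContinuousMap.norm_toBCF_eq_norm]
  exact x.toBCF.norm_coe_le_norm n

theorem norm_le_of_abs_apply_le (x : C₀(ℕ, ℝ)) {c : ℝ} (hc : 0 ≤ c) (h : ∀ n, |x n| ≤ c) :
    ‖x‖ ≤ c := by
  rw [← ZeroAtInftyContinuousMap.norm_toBCF_eq_norm]
  exact (BoundedContinuousFunction.norm_le hc).2 h

theorem tendsto_truncation (x : C₀(ℕ, ℝ)) :
    Tendsto (fun m => truncation m x) atTop (𝓝 x) := by
  rw [Metric.tendsto_atTop]
  intro ε hε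
  have hx : Tendsto x atTop (𝓝 0) := by
    have := x.zero_at_infty'
    rwa [Filter.cocompact_eq_cofinite, Nat.cofinite_eq_atTop] at this
  obtain ⟨M, hM⟩ := Metric.tendsto_atTop.1 hx (ε / 2) (half_pos hε)
  refine ⟨M, fun m hm => ?_⟩
  rw [dist_eq_norm]
  refine lt_of_le_of_lt (norm_le_of_abs_apply_le _ (half_pos hε).le fun n => ?_) (half_lt_self hε)
  rw [ZeroAtInftyContinuousMap.sub_apply, truncation_apply]
  split_ifs with h
  · simpa using (half_pos hε).le
  · have := hM n (by omega)
    rw [Real.dist_eq, sub_zero] at this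
    simpa using this.le

section

variable {α : ℕ → ℝ} {a : ℝ}

theorem sum_mul_abs_le (hα : ∀ n, 0 < α n) (hsum : HasSum α a) (s : Finset ℕ)
    (x : ℕ → ℝ) {c : ℝ} (hc : 0 ≤ c) (hx : ∀ n, |x n| ≤ c) :
    ∑ j ∈ s, α j * |x j| ≤ a * c :=
  calc ∑ j ∈ s, α j * |x j| ≤ ∑ j ∈ s, α j * c :=
        Finset.sum_le_sum fun j _ => mul_le_mul_of_nonneg_left (hx j) (hα j).le
    _ = (∑ j ∈ s, α j) * c := by rw [Finset.sum_mul]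
    _ ≤ a * c := mul_le_mul_of_nonneg_right
        (sum_le_hasSum s (fun j _ => (hα j).le) hsum) hc

theorem weightedNorm_le_iff (hα : ∀ n, 0 < α n) (hsum : HasSum α a) (x : C₀(ℕ, ℝ)) {c : ℝ} :
    weightedNorm α x ≤ c ↔
      ∀ n, |x n| + ∑ j ∈ Finset.range (n + 1), α j * |x j| ≤ c := by
  refine ciSup_le_iff ⟨‖x‖ + a * ‖x‖, ?_⟩
  rintro _ ⟨n, rfl⟩
  exact add_le_add (abs_apply_le_norm x n)
    (sum_mul_abs_le hα hsum _ x (norm_nonneg x) (abs_apply_le_norm x))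

theorem abs_apply_le_one (hα : ∀ n, 0 < α n) (hsum : HasSum α a) {x : C₀(ℕ, ℝ)}
    (hx : weightedNorm α x ≤ 1) (n : ℕ) : |x n| ≤ 1 :=
  le_trans (le_add_of_nonneg_right
    (Finset.sum_nonneg fun j _ => mul_nonneg (hα j).le (abs_nonneg _)))
    ((weightedNorm_le_iff hα hsum x).1 hx n)

theorem weightedNorm_le_one_of_abs_le (hα : ∀ n, 0 < α n) (hsum : HasSum α a)
    {x y : C₀(ℕ, ℝ)} (hx : weightedNorm α x ≤ 1) (h : ∀ n, |y n| ≤ |x n|) :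
    weightedNorm α y ≤ 1 := by
  rw [weightedNorm_le_iff hα hsum] at hx ⊢
  intro n
  refine le_trans (add_le_add (h n) (Finset.sum_le_sum fun j _ => ?_)) (hx n)
  exact mul_le_mul_of_nonneg_left (h j) (hα j).le

theorem abs_map_le_opNorm (hα : ∀ n, 0 < α n) (hsum : HasSum α a)
    (f : C₀(ℕ, ℝ) →L[ℝ] ℝ) {x : C₀(ℕ, ℝ)} (hx : weightedNorm α x ≤ 1) : |f x| ≤ ‖f‖ :=
  f.unit_le_opNorm x (norm_le_of_abs_apply_le x zero_le_one (abs_apply_le_one hα hsum hx))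

theorem abs_map_le_weightedDualNorm (hα : ∀ n, 0 < α n) (hsum : HasSum α a)
    (f : C₀(ℕ, ℝ) →L[ℝ] ℝ) {x : C₀(ℕ, ℝ)} (hx : weightedNorm α x ≤ 1) :
    |f x| ≤ weightedDualNorm α f := by
  refine le_csSup ⟨‖f‖, ?_⟩ ⟨x, hx, rfl⟩
  rintro _ ⟨y, hy, rfl⟩
  exact abs_map_le_opNorm hα hsum f hy

theorem weightedNorm_zero_le_one : weightedNorm α 0 ≤ 1 := by
  simp [weightedNorm]

theorem weightedDualNorm_nonneg (f : C₀(ℕ, ℝ) →L[ℝ] ℝ) : 0 ≤ weightedDualNorm α f := by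
  refine Real.sSup_nonneg ?_
  rintro _ ⟨x, _, rfl⟩
  exact abs_nonneg _

theorem weightedDualNorm_le_opNorm (hα : ∀ n, 0 < α n) (hsum : HasSum α a)
    (f : C₀(ℕ, ℝ) →L[ℝ] ℝ) : weightedDualNorm α f ≤ ‖f‖ := by
  refine csSup_le ⟨|f 0|, 0, weightedNorm_zero_le_one, rfl⟩ ?_
  rintro _ ⟨y, hy, rfl⟩
  exact abs_map_le_opNorm hα hsum f hy

theorem exists_lt_map_of_lt_weightedDualNorm (hα : ∀ n, 0 < α n) (hsum : HasSum α a)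
    (f : C₀(ℕ, ℝ) →L[ℝ] ℝ) {c : ℝ} (hc : c < weightedDualNorm α f) :
    ∃ x, weightedNorm α x ≤ 1 ∧ c < f x := by
  obtain ⟨_, ⟨x, hx, rfl⟩, hcx⟩ :=
    exists_lt_of_lt_csSup (by exact ⟨|f 0|, 0, weightedNorm_zero_le_one, rfl⟩) hc
  rcases lt_abs.1 hcx with h | h
  · exact ⟨x, hx, h⟩
  · exact ⟨-x, weightedNorm_le_one_of_abs_le hα hsum hx fun n => by simp, by simpa using h⟩

/-- A finitely supported vector `x` of the unit ball may be perturbed by `1 - a` times any vector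
of the unit ball supported beyond `x` without leaving the ball. -/
theorem weightedNorm_add_smul_le_one (hα : ∀ n, 0 < α n) (hsum : HasSum α a)
    (ha : a ∈ Set.Ioo (0 : ℝ) 1) {x y : C₀(ℕ, ℝ)} (hx : weightedNorm α x ≤ 1)
    (hy : weightedNorm α y ≤ 1) {m : ℕ} (hxm : ∀ n, m ≤ n → x n = 0)
    (hym : ∀ n, n < m → y n = 0) :
    weightedNorm α (x + (1 - a) • y) ≤ 1 := by
  have ha1 : 0 ≤ 1 - a := by linarith [ha.2]
  rw [weightedNorm_le_iff hα hsum]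
  intro n
  have hterm : ∀ j, |(x + (1 - a) • y) j| ≤ |x j| + (1 - a) * |y j| := fun j => by
    rw [ZeroAtInftyContinuousMap.add_apply, ZeroAtInftyContinuousMap.smul_apply, smul_eq_mul]
    refine (abs_add_le _ _).trans (le_of_eq ?_)
    rw [abs_mul, abs_of_nonneg ha1]
  have hS : ∑ j ∈ Finset.range (n + 1), α j * |(x + (1 - a) • y) j| ≤
      ∑ j ∈ Finset.range (n + 1), α j * |x j| +
        (1 - a) * ∑ j ∈ Finset.range (n + 1), α j * |y j| := by
    rw [Finset.mul_sum, ← Finset.sum_add_distrib]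
    refine Finset.sum_le_sum fun j _ => ?_
    have := mul_le_mul_of_nonneg_left (hterm j) (hα j).le
    linarith
  have hn := hterm n
  rcases lt_or_ge n m with h | h
  · have hy0 : ∑ j ∈ Finset.range (n + 1), α j * |y j| = 0 := by
      refine Finset.sum_eq_zero fun j hj => ?_
      rw [hym j (by have := Finset.mem_range.1 hj; omega)]
      simp
    rw [hy0] at hS
    rw [hym n h] at hn
    have := (weightedNorm_le_iff hα hsum x).1 hx n
    simp only [abs_zero, mul_zero, add_zero] at hS hn
    linarith
  · rw [hxm n h, abs_zero, zero_add] at hn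
    have h1 := sum_mul_abs_le hα hsum (Finset.range (n + 1)) x zero_le_one
      (abs_apply_le_one hα hsum hx)
    have h2 := mul_le_mul_of_nonneg_left ((weightedNorm_le_iff hα hsum y).1 hy n) ha1
    linarith

theorem eventually_le_weightedDualNorm_add (hα : ∀ n, 0 < α n) (hsum : HasSum α a)
    (ha : a ∈ Set.Ioo (0 : ℝ) 1) (f : C₀(ℕ, ℝ) →L[ℝ] ℝ) (g : ℕ → C₀(ℕ, ℝ) →L[ℝ] ℝ)
    (hg : ∀ x, Tendsto (fun n => g n x) atTop (𝓝 0)) {ε : ℝ} (hε : 0 < ε) :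
    ∀ᶠ n in atTop, weightedDualNorm α f + (1 - a) * weightedDualNorm α (g n) - 5 * ε ≤
      weightedDualNorm α (f + g n) := by
  have ha1 : 0 < 1 - a := by linarith [ha.2]
  obtain ⟨x₀, hx₀, hfx₀⟩ := exists_lt_map_of_lt_weightedDualNorm hα hsum f
    (show weightedDualNorm α f - ε < _ by linarith)
  obtain ⟨m, hm⟩ := (((f.continuous.tendsto x₀).comp (tendsto_truncation x₀)).eventually
    (lt_mem_nhds hfx₀)).exists
  set x := truncation m x₀ with hxdef
  have hfx : weightedDualNorm α f - ε < f x := hm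
  have hx : weightedNorm α x ≤ 1 := weightedNorm_le_one_of_abs_le hα hsum hx₀ fun n => by
    rw [hxdef, truncation_apply]
    split_ifs <;> simp
  have hxm : ∀ n, m ≤ n → x n = 0 := fun n hn => by
    rw [hxdef, truncation_apply, if_neg (by omega)]
  have hbasis : Tendsto (fun n => ∑ k ∈ Finset.range m, |g n (e k)|) atTop (𝓝 0) := by
    simpa using tendsto_finsetSum (Finset.range m) fun k _ => (hg (e k)).abs
  have hgx : Tendsto (fun n => |g n x|) atTop (𝓝 0) := by simpa using (hg x).abs
  filter_upwards [hbasis.eventually (gt_mem_nhds hε), hgx.eventually (gt_mem_nhds hε)]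
    with n hn1 hn2
  obtain ⟨y₀, hy₀, hgy₀⟩ := exists_lt_map_of_lt_weightedDualNorm hα hsum (g n)
    (show weightedDualNorm α (g n) - ε < _ by linarith)
  set y := y₀ - truncation m y₀ with hydef
  have hy_apply : ∀ k, y k = if k < m then 0 else y₀ k := fun k => by
    rw [hydef, ZeroAtInftyContinuousMap.sub_apply, truncation_apply]
    split_ifs <;> simp
  have hy : weightedNorm α y ≤ 1 := weightedNorm_le_one_of_abs_le hα hsum hy₀ fun k => by
    rw [hy_apply]
    split_ifs <;> simp
  have hym : ∀ k, k < m → y k = 0 := fun k hk => by rw [hy_apply, if_pos hk]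
  have htrunc : |g n (truncation m y₀)| ≤ ∑ k ∈ Finset.range m, |g n (e k)| := by
    rw [truncation, map_sum]
    refine (Finset.abs_sum_le_sum_abs _ _).trans (Finset.sum_le_sum fun k _ => ?_)
    rw [map_smul, smul_eq_mul, abs_mul]
    exact mul_le_of_le_one_left (abs_nonneg _) (abs_apply_le_one hα hsum hy₀ k)
  have hgy : weightedDualNorm α (g n) - 2 * ε ≤ g n y := by
    rw [hydef, map_sub]
    linarith [le_abs_self (g n (truncation m y₀))]
  -- near-maximality of `x` forces `f` to be small on `(1 - a) • y`
  have hfy : -ε ≤ (1 - a) * f y := by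
    have hneg : weightedNorm α (-y) ≤ 1 :=
      weightedNorm_le_one_of_abs_le hα hsum hy fun k => by simp
    have h := (le_abs_self _).trans (abs_map_le_weightedDualNorm hα hsum f
      (weightedNorm_add_smul_le_one hα hsum ha hx hneg hxm fun k hk => by simp [hym k hk]))
    rw [map_add, map_smul, map_neg, smul_eq_mul] at h
    linarith
  have h := (le_abs_self _).trans (abs_map_le_weightedDualNorm hα hsum (f + g n)
    (weightedNorm_add_smul_le_one hα hsum ha hx hy hxm hym))
  rw [add_apply, map_add, map_add, map_smul, map_smul, smul_eq_mul,
    smul_eq_mul] at h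
  have h1 := mul_le_mul_of_nonneg_left hgy ha1.le
  have h2 : (1 - a) * ε ≤ ε := by nlinarith [ha.1]
  linarith [neg_abs_le (g n x)]

theorem weightedDualNorm_lkk (hα : ∀ n, 0 < α n) (hsum : HasSum α a)
    (ha : a ∈ Set.Ioo (0 : ℝ) 1) (f : C₀(ℕ, ℝ) →L[ℝ] ℝ) (g : ℕ → C₀(ℕ, ℝ) →L[ℝ] ℝ)
    (hg : ∀ x, Tendsto (fun n => g n x) atTop (𝓝 0)) :
    weightedDualNorm α f + (1 - a) * limsup (fun n => weightedDualNorm α (g n)) atTop ≤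
      limsup (fun n => weightedDualNorm α (f + g n)) atTop := by
  have ha1 : 0 < 1 - a := by linarith [ha.2]
  have ha0 := ha.1
  obtain ⟨C, hC⟩ : ∃ C, ∀ n, ‖g n‖ ≤ C := by
    refine banach_steinhaus fun x => ?_
    obtain ⟨C, hC⟩ := (hg x).norm.bddAbove_range
    exact ⟨C, fun n => hC ⟨n, rfl⟩⟩
  have hbdd : IsBoundedUnder (· ≤ ·) atTop fun n => weightedDualNorm α (f + g n) :=
    isBoundedUnder_of ⟨‖f‖ + C, fun n => (weightedDualNorm_le_opNorm hα hsum _).trans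
      ((f.opNorm_add_le (g n)).trans (add_le_add_right (hC n) ‖f‖))⟩
  have hcobdd : IsCoboundedUnder (· ≤ ·) atTop fun n => weightedDualNorm α (g n) :=
    IsBoundedUnder.isCoboundedUnder_le
      (isBoundedUnder_of ⟨0, fun n => weightedDualNorm_nonneg _⟩)
  refine le_of_forall_pos_le_add fun ε hε => ?_
  have hfreq := frequently_lt_of_lt_limsup hcobdd
    (show limsup (fun n => weightedDualNorm α (g n)) atTop - ε / 6 < _ by linarith)
  have hev := eventually_le_weightedDualNorm_add hα hsum ha f g hg (show 0 < ε / 6 by linarith)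
  have hle : weightedDualNorm α f +
      (1 - a) * limsup (fun n => weightedDualNorm α (g n)) atTop - ε ≤
        limsup (fun n => weightedDualNorm α (f + g n)) atTop := by
    refine le_limsup_of_frequently_le ((hfreq.and_eventually hev).mono ?_) hbdd
    rintro n ⟨h1, h2⟩
    have h3 := mul_le_mul_of_nonneg_left h1.le ha1.le
    nlinarith
  linarith

end

/-- The space `c₀` with the norm `‖x‖ = sup_n (|x_n| + ∑_{j≤n} α_j |x_j|)`, where the
`α_n` are positive with `∑ α_n = a ∈ (0,1)`, satisfies the `(1, 1-a)`-LKK* property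
(with respect to this norm and the dual norm it induces). -/
theorem stmt_19 (α : ℕ → ℝ) (hα : ∀ n, 0 < α n) (a : ℝ) (hsum : HasSum α a)
    (ha : a ∈ Set.Ioo (0 : ℝ) 1) :
    -- the norm of the space X
    let N : ZeroAtInftyContinuousMap ℕ ℝ → ℝ :=
      fun x => ⨆ n : ℕ, (|x n| + ∑ j ∈ Finset.range (n + 1), α j * |x j|)
    -- the dual norm induced by N on X*
    let Nd : (ZeroAtInftyContinuousMap ℕ ℝ →L[ℝ] ℝ) → ℝ :=
      fun f => sSup {c : ℝ | ∃ x : ZeroAtInftyContinuousMap ℕ ℝ, N x ≤ 1 ∧ c = |f x|}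
    -- X satisfies the (1, 1-a)-LKK* property
    ∀ (f : ZeroAtInftyContinuousMap ℕ ℝ →L[ℝ] ℝ)
      (g : ℕ → ZeroAtInftyContinuousMap ℕ ℝ →L[ℝ] ℝ),
      (∀ x : ZeroAtInftyContinuousMap ℕ ℝ, Tendsto (fun n => g n x) atTop (𝓝 0)) →
      1 * Nd f + (1 - a) * limsup (fun n => Nd (g n)) atTop ≤
        limsup (fun n => Nd (f + g n)) atTop := by
  intro N Nd f g hg
  rw [one_mul]
  exact weightedDualNorm_lkk hα hsum ha f g hg
end
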